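/- arXiv:1405.1701 — 2 statements merged into one kernel-verified Lean document; each statement's English description precedes it below -/
import Mathlib

section
/- Let n ≥ 7 and let 𝓓 = (Ω, 𝓑) be a supersimple 2-(n,4,2) design. Then n ≡ 1 (mod 3), and if n ≠ 10 then for every ∞ ∈ Ω the hole stabilizer π_∞(𝓓) is exactly the full symmetric group on Ω \ {∞}, i.e. π_∞(𝓓) = { g ∈ Sym(Ω) : g(∞) = ∞ }. -/
open Equiv

variable {Ω : Type*} [DecidableEq Ω] [Fintype Ω]

/-- Two points of a 4-hypergraph are collinear if they are equal or some line contains both. -/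
def HGCollinear (B : Finset (Finset Ω)) (x y : Ω) : Prop :=
  x = y ∨ ∃ b ∈ B, x ∈ b ∧ y ∈ b

/-- A 4-hypergraph is pliable if any two lines sharing three pairwise distinct points are equal. -/
def HGPliable (B : Finset (Finset Ω)) : Prop :=
  ∀ b₁ ∈ B, ∀ b₂ ∈ B, ∀ p q r : Ω, p ≠ q → p ≠ r → q ≠ r →
    p ∈ b₁ → q ∈ b₁ → r ∈ b₁ → p ∈ b₂ → q ∈ b₂ → r ∈ b₂ → b₁ = b₂

/-- `g` is the elementary move `[x,y]`: it interchanges `x` and `y`, interchanges the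
remaining two points of every line through `x` and `y`, and fixes everything else.
For `x = y` it is the identity. -/
def IsElemMove (B : Finset (Finset Ω)) (x y : Ω) (g : Equiv.Perm Ω) : Prop :=
  (x = y ∧ g = 1) ∨
  (x ≠ y ∧ (∃ b ∈ B, x ∈ b ∧ y ∈ b) ∧ g x = y ∧ g y = x ∧
    ∀ z : Ω, z ≠ x → z ≠ y →
      ((∀ b ∈ B, ¬(x ∈ b ∧ y ∈ b ∧ z ∈ b)) → g z = z) ∧
      (∀ b ∈ B, x ∈ b → y ∈ b → z ∈ b →
        ∀ w ∈ b, w ≠ x → w ≠ y → w ≠ z → g z = w))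

/-- `g` is the move sequence `[a₀,…,a_k]` recorded by the list
(elementary moves applied left to right). -/
def IsMoveSeq (B : Finset (Finset Ω)) : List Ω → Equiv.Perm Ω → Prop
  | [], _ => False
  | [_], g => g = 1
  | a :: b :: l, g => ∃ e h : Equiv.Perm Ω,
      IsElemMove B a b e ∧ IsMoveSeq B (b :: l) h ∧ g = h * e

/-- The puzzle set `𝓛_𝓓` of all move sequences. -/
def puzzleSet (B : Finset (Finset Ω)) : Set (Equiv.Perm Ω) :=
  { g | ∃ l : List Ω, IsMoveSeq B l g }

/-- The hole stabiliser `π_x(𝓓)`: all closed move sequences starting and ending at `x`. -/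
def holeStab (B : Finset (Finset Ω)) (x : Ω) : Set (Equiv.Perm Ω) :=
  { g | ∃ l : List Ω, l.head? = some x ∧ l.getLast? = some x ∧ IsMoveSeq B l g }

/-- `(Ω, B)` is a 2-(n,4,λ) design: lines have four points and every pair of distinct
points lies in exactly `lam` lines. -/
def IsTwoDesign (B : Finset (Finset Ω)) (lam : ℕ) : Prop :=
  (∀ b ∈ B, b.card = 4) ∧
  ∀ p q : Ω, p ≠ q → (B.filter fun b => p ∈ b ∧ q ∈ b).card = lam

/-- Supersimple: any two distinct lines meet in at most two points. -/
def HGSupersimple (B : Finset (Finset Ω)) : Prop :=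
  ∀ b₁ ∈ B, ∀ b₂ ∈ B, b₁ ≠ b₂ → (b₁ ∩ b₂).card ≤ 2

/-- `x ∈ overline{a,c}`: `x` is `a`, `c`, or lies on a line containing both `a` and `c`. -/
def HGLineClosure (B : Finset (Finset Ω)) (a c x : Ω) : Prop :=
  x = a ∨ x = c ∨ ∃ b ∈ B, a ∈ b ∧ c ∈ b ∧ x ∈ b

/-- A system of imprimitivity for the hole stabiliser `π_x` acting on `Ω \ {x}`,
with `ℓ` blocks each of size `k`. -/
def IsHoleBlockSystem (B : Finset (Finset Ω)) (x : Ω) (P : Finset (Finset Ω))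
    (k ℓ : ℕ) : Prop :=
  P.card = ℓ ∧ 1 < k ∧ 1 < ℓ ∧ (∀ Δ ∈ P, Δ.card = k) ∧
  (∀ a : Ω, a ≠ x → ∃! Δ : Finset Ω, Δ ∈ P ∧ a ∈ Δ) ∧
  (∀ Δ ∈ P, x ∉ Δ) ∧
  (∀ g ∈ holeStab B x, ∀ Δ ∈ P, Δ.image (⇑g) ∈ P)

section
variable {α : Type*} [DecidableEq α] [Fintype α]

theorem isThreeCycle_commutator_of_support_inter (g h : Perm α) (c : α)
    (hc : g.support ∩ h.support = {c}) : (g * h * g⁻¹ * h⁻¹).IsThreeCycle := by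
  have key : ∀ z, g z ≠ z → h z ≠ z → z = c := by
    intro z h1 h2
    have : z ∈ g.support ∩ h.support := by simp [h1, h2]
    simpa [hc] using this
  have hcm : c ∈ g.support ∩ h.support := by simp [hc]
  simp only [Finset.mem_inter, Perm.mem_support] at hcm
  obtain ⟨hg, hh⟩ := hcm
  have hne : h c ≠ g c := by
    intro q
    exact hh (key (h c) (by rw [q]; exact fun r => hg (g.injective r))
        (fun r => hh (h.injective r)))
  have e : g * h * g⁻¹ * h⁻¹ = swap c (h c) * swap c (g c) := by
    rw [mul_inv_eq_iff_eq_mul, mul_inv_eq_iff_eq_mul]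
    ext z
    simp only [Perm.mul_apply]
    have gi := g.injective
    have hi := h.injective
    have k1 : ∀ z, z ≠ c → g z ≠ z → h z = z := by grind
    have k2 : ∀ z, z ≠ c → h z ≠ z → g z = z := by grind
    have k3 : h (g c) = g c := k1 _ hg (fun q => hg (gi q))
    have k4 : g (h c) = h c := k2 _ hh (fun q => hh (hi q))
    by_cases hz : z = c
    · subst hz; rw [k3, k4, swap_apply_right, swap_apply_left]
    by_cases h1 : g z = z
    · rw [h1]
      by_cases h2 : h z = z
      · rw [h2, h1, swap_apply_of_ne_of_ne hz (by grind), swap_apply_of_ne_of_ne hz (by grind)]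
      · by_cases h3 : h z = c
        · rw [h3, swap_apply_left, swap_apply_of_ne_of_ne (by grind) (by grind)]
        · have : h (h z) ≠ h z := fun q => h2 (hi q)
          rw [k2 _ h3 this, swap_apply_of_ne_of_ne (by grind) (by grind),
            swap_apply_of_ne_of_ne (by grind) (by grind)]
    · have h2 := k1 z hz h1
      rw [h2]
      by_cases h3 : g z = c
      · rw [h3, swap_apply_of_ne_of_ne hh hne, swap_apply_right]
      · have : g (g z) ≠ g z := fun q => h1 (gi q)
        rw [k1 _ h3 this, swap_apply_of_ne_of_ne (by grind) (by grind),
          swap_apply_of_ne_of_ne (by grind) (by grind)]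
  rw [e]
  exact Perm.isThreeCycle_swap_mul_swap_same hh.symm hg.symm hne

/-- `G` acts transitively on ordered pairs of distinct points. -/
def TwoTrans (G : Subgroup (Perm α)) : Prop :=
  ∀ a b c d : α, a ≠ b → c ≠ d → ∃ g ∈ G, g a = c ∧ g b = d

open Classical in
/-- Each ordered pair of distinct points is mapped to each other one by exactly `K` elements. -/
def PairCount (G : Subgroup (Perm α)) (K : ℕ) : Prop :=
  ∀ U V : Finset (α × α), (∀ p ∈ U, p.1 ≠ p.2) → (∀ p ∈ V, p.1 ≠ p.2) →
    ∑ σ : G, (V.filter fun q => ((σ : Perm α)⁻¹ q.1, (σ : Perm α)⁻¹ q.2) ∈ U).card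
      = K * (U.card * V.card)

open Classical in
theorem TwoTrans.exists_pairCount {G : Subgroup (Perm α)} (h2 : TwoTrans G) :
    ∃ K : ℕ, 0 < K ∧ PairCount G K := by
  by_cases hne : ∃ a b : α, a ≠ b
  · obtain ⟨a, b, hab⟩ := hne
    let K := (Finset.univ.filter fun σ : G => (σ : Perm α) a = a ∧ (σ : Perm α) b = b).card
    have hK : ∀ p q : α × α, p.1 ≠ p.2 → q.1 ≠ q.2 → (Finset.univ.filter fun σ : G =>
        (σ : Perm α) p.1 = q.1 ∧ (σ : Perm α) p.2 = q.2).card = K := by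
      intro p q hp hq
      obtain ⟨s, hs, s1, s2⟩ := h2 a b p.1 p.2 hab hp
      obtain ⟨t, ht, t1, t2⟩ := h2 q.1 q.2 a b hq hab
      refine Finset.card_bij' (fun σ _ => ⟨t, ht⟩ * σ * ⟨s, hs⟩)
        (fun σ _ => ⟨t, ht⟩⁻¹ * σ * ⟨s, hs⟩⁻¹) ?_ ?_ ?_ ?_
      · intro σ hσ
        simp at hσ ⊢
        simp [s1, s2, hσ, t1, t2]
      · intro σ hσ
        simp at hσ ⊢
        rw [← s1, ← s2]
        simp [hσ, Equiv.symm_apply_eq, t1, t2]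
      · intro σ _; group
      · intro σ _; group
    refine ⟨K, Finset.card_pos.mpr ⟨1, by simp⟩, fun U V hU hV => ?_⟩
    calc _ = ∑ σ : G, ∑ q ∈ V, ∑ p ∈ U,
            if (σ : Perm α) p.1 = q.1 ∧ (σ : Perm α) p.2 = q.2 then 1 else 0 := by
          refine Finset.sum_congr rfl fun σ _ => ?_
          rw [Finset.card_filter]
          refine Finset.sum_congr rfl fun q _ => ?_
          have : ∀ p : α × α, ((σ : Perm α) p.1 = q.1 ∧ (σ : Perm α) p.2 = q.2) ↔
              ((σ : Perm α)⁻¹ q.1, (σ : Perm α)⁻¹ q.2) = p := by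
            intro p
            rw [Prod.ext_iff, Perm.inv_eq_iff_eq, Perm.inv_eq_iff_eq]
            exact ⟨fun h => ⟨h.1.symm, h.2.symm⟩, fun h => ⟨h.1.symm, h.2.symm⟩⟩
          simp only [this]
          rw [Finset.sum_ite_eq]
      _ = ∑ q ∈ V, ∑ p ∈ U, K := by
          rw [Finset.sum_comm]
          refine Finset.sum_congr rfl fun q hq => ?_
          rw [Finset.sum_comm]
          refine Finset.sum_congr rfl fun p hp => ?_
          rw [← Finset.card_filter, hK p q (hU p hp) (hV q hq)]
      _ = _ := by simp; ring
  · push Not at hne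
    refine ⟨1, one_pos, fun U V hU hV => ?_⟩
    have : V = ∅ := Finset.eq_empty_of_forall_notMem fun q hq => hV q hq (hne _ _)
    simp [this]
end

section
variable {α : Type*} [DecidableEq α] [Fintype α]


/-- The points of `S` that are images of points of `S` under `σ`. -/
def common (S : Finset α) (σ : Perm α) : Finset α := S.filter fun c => σ⁻¹ c ∈ S

theorem PairCount.sum_common {G : Subgroup (Perm α)} {K : ℕ} (h : PairCount G K) (S : Finset α) :
    letI := Classical.decPred (· ∈ G)
    (∑ σ : G, (common S σ).card) * (Fintype.card α - 1) =
        K * (S.card * (Fintype.card α - 1) * (S.card * (Fintype.card α - 1))) ∧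
      ∑ σ : G, ((common S σ).card * (common S σ).card - (common S σ).card) =
        K * ((S.card * S.card - S.card) * (S.card * S.card - S.card)) := by
  classical
  have hpt := h (Finset.univ.filter fun p : α × α => p.1 ∈ S ∧ p.1 ≠ p.2)
    (Finset.univ.filter fun p : α × α => p.1 ∈ S ∧ p.1 ≠ p.2) (by simp) (by simp)
  have hpr := h S.offDiag S.offDiag (by simp) (by simp)
  have hpc : ∀ T : Finset α, (Finset.univ.filter fun p : α × α => p.1 ∈ T ∧ p.1 ≠ p.2).card
      = T.card * (Fintype.card α - 1) := by
    intro T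
    have : (Finset.univ.filter fun p : α × α => p.1 ∈ T ∧ p.1 ≠ p.2) =
        T.biUnion fun a => (Finset.univ.erase a).image fun b => (a, b) := by
      ext ⟨a, b⟩
      simp [eq_comm]
    rw [this, Finset.card_biUnion]
    · rw [Finset.sum_const_nat]
      intro a _
      rw [Finset.card_image_of_injective _ (Prod.mk_right_injective a),
        Finset.card_erase_of_mem (by simp),
        Finset.card_univ]
    · intro a _ b _ hab
      rw [Function.onFun, Finset.disjoint_left]
      rintro ⟨x, y⟩ hx hy
      simp only [Finset.mem_image, Prod.mk.injEq] at hx hy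
      obtain ⟨_, _, rfl, _⟩ := hx
      obtain ⟨_, _, rfl, _⟩ := hy
      exact hab rfl
  have e1 : ∀ σ : G, ((Finset.univ.filter fun p : α × α => p.1 ∈ S ∧ p.1 ≠ p.2).filter fun q =>
      ((σ : Perm α)⁻¹ q.1, (σ : Perm α)⁻¹ q.2) ∈
        (Finset.univ.filter fun p : α × α => p.1 ∈ S ∧ p.1 ≠ p.2)).card =
      (common S σ).card * (Fintype.card α - 1) := by
    intro σ
    rw [← hpc]
    congr 1
    ext p
    simp only [common, Finset.mem_filter, Finset.mem_univ, true_and, ne_eq,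
        EmbeddingLike.apply_eq_iff_eq]
    tauto
  have e2 : ∀ σ : G, (S.offDiag.filter fun q =>
      ((σ : Perm α)⁻¹ q.1, (σ : Perm α)⁻¹ q.2) ∈ S.offDiag).card =
      (common S σ).card * (common S σ).card
        - (common S σ).card := by
    intro σ
    rw [← Finset.offDiag_card]
    congr 1
    ext p
    simp only [common, Finset.mem_filter, Finset.mem_offDiag, ne_eq, EmbeddingLike.apply_eq_iff_eq]
    tauto
  simp only [e1, e2, hpc, Finset.offDiag_card, ← Finset.sum_mul] at hpt hpr
  exact ⟨by convert hpt, by convert hpr⟩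

omit [Fintype α] in
theorem card_common_one (S : Finset α) : (common S 1).card = S.card := by
  rw [common, Finset.filter_true_of_mem]
  intro x hx
  simpa using hx

theorem common_support (g σ : Perm α) :
    common g.support σ = g.support ∩ (σ * g * σ⁻¹).support := by
  ext z
  simp only [common, Finset.mem_inter, Finset.mem_filter, Perm.mem_support, Perm.mul_apply, ne_eq,
    Perm.eq_inv_iff_eq]

theorem exists_isThreeCycle_of_card_support {G : Subgroup (Perm α)} (h2 : TwoTrans G)
    {g : Perm α} (hg : g ∈ G) (h3 : 3 ≤ g.support.card)
    (hs : (g.support.card - 1) ^ 2 + 1 ≤ Fintype.card α) :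
    ∃ c ∈ G, c.IsThreeCycle := by
  classical
  obtain ⟨K, hK, hsum⟩ := h2.exists_pairCount
  set S := g.support with hS
  by_contra hno
  have hX : ∀ σ : G, (common S σ).card ≠ 1 := by
    intro σ h1
    obtain ⟨c, hc⟩ := Finset.card_eq_one.mp h1
    refine hno ⟨_, ?_, isThreeCycle_commutator_of_support_inter g (σ * g * (σ : Perm α)⁻¹) c ?_⟩
    · have hh : (σ : Perm α) * g * (σ : Perm α)⁻¹ ∈ G :=
        G.mul_mem (G.mul_mem σ.2 hg) (G.inv_mem σ.2)
      exact G.mul_mem (G.mul_mem (G.mul_mem hg hh) (G.inv_mem hg)) (G.inv_mem hh)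
    · rw [← hc, hS, common_support]
  have hpt := (hsum.sum_common S).1
  have hpr := (hsum.sum_common S).2
  set X : G → ℕ := fun σ => (common S σ).card with hXdef
  have hlt : ∑ σ : G, X σ < ∑ σ : G, (X σ * X σ - X σ) := by
    refine Finset.sum_lt_sum (fun σ _ => ?_) ⟨1, Finset.mem_univ _, ?_⟩
    · have := hX σ
      change X σ ≠ 1 at this
      rcases Nat.lt_or_ge (X σ) 2 with h | h
      · have : X σ = 0 := by omega
        simp [this]
      · have : X σ * 2 ≤ X σ * X σ := Nat.mul_le_mul_left _ h
        omega
    · have : X 1 = S.card := card_common_one S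
      rw [this]
      have : S.card * 3 ≤ S.card * S.card := Nat.mul_le_mul_left _ h3
      omega
  obtain ⟨t, ht⟩ : ∃ t, S.card = t + 1 := ⟨S.card - 1, by omega⟩
  obtain ⟨m, hm⟩ : ∃ m, Fintype.card α = m + 1 := ⟨Fintype.card α - 1, by omega⟩
  have q1 : S.card * S.card - S.card = (t + 1) * t := by rw [ht]; ring_nf; omega
  rw [q1] at hpr
  rw [hm] at hpt hs
  rw [ht] at hpt hs
  simp only [Nat.add_sub_cancel] at hpt hs
  replace hpt : (∑ σ, X σ) * m = K * ((t + 1) * m * ((t + 1) * m)) := by convert hpt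
  replace hpr : (∑ σ, (X σ * X σ - X σ)) = K * ((t + 1) * t * ((t + 1) * t)) := by convert hpr
  have hm0 : 0 < m := by nlinarith
  have : (∑ σ, X σ) * m < (∑ σ : G, (X σ * X σ - X σ)) * m := Nat.mul_lt_mul_of_pos_right hlt hm0
  rw [hpt, hpr] at this
  have hs' : t ^ 2 ≤ m := by omega
  have : K * ((t + 1) * t * ((t + 1) * t)) * m ≤ K * ((t + 1) * m * ((t + 1) * m)) := by
    calc _ = K * (t + 1) ^ 2 * m * t ^ 2 := by ring
      _ ≤ K * (t + 1) ^ 2 * m * m := Nat.mul_le_mul_left _ hs'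
      _ = _ := by ring
  omega
end

section
variable {α : Type*} [DecidableEq α] [Fintype α]

omit [DecidableEq α] [Fintype α] in
theorem TwoTrans.isPreprimitive {G : Subgroup (Perm α)} (h2 : TwoTrans G) :
    MulAction.IsPreprimitive G α := by
  apply MulAction.isPreprimitive_of_is_two_pretransitive
  rw [MulAction.is_two_pretransitive_iff]
  intro a b c d hab hcd
  obtain ⟨g, hg, h1, h2⟩ := h2 a b c d hab hcd
  exact ⟨⟨g, hg⟩, h1, h2⟩

theorem exists_isThreeCycle_of_five_cycle {G : Subgroup (Perm α)} (h2 : TwoTrans G)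
    {g : Perm α} (hg : g ∈ G) (hc : g.IsCycle) (h5 : g.support.card = 5)
    (hα : 10 ≤ Fintype.card α) : ∃ c ∈ G, c.IsThreeCycle := by
  classical
  have hsc : ((g.support : Set α)ᶜ).ncard = Fintype.card α - 5 := by
    rw [Set.ncard_compl, Set.ncard_coe_finset, h5, Nat.card_eq_fintype_card]
  have ht := Equiv.Perm.isPretransitive_of_isCycle_mem hc hg
  have hp : MulAction.IsPreprimitive (fixingSubgroup G (g.support : Set α)ᶜ)
      (SubMulAction.ofFixingSubgroup G (g.support : Set α)ᶜ) := by
    apply MulAction.IsPreprimitive.of_prime_card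
    have : Nat.card (SubMulAction.ofFixingSubgroup G (g.support : Set α)ᶜ) = 5 := by
      change Nat.card ↥((g.support : Set α)ᶜᶜ) = 5
      rw [compl_compl, Nat.card_coe_set_eq, Set.ncard_coe_finset, h5]
    rw [this]; norm_num
  have hm := h2.isPreprimitive.isMultiplyPreprimitive (s := (g.support : Set α)ᶜ)
    (n := Fintype.card α - 6) (by omega) (by rw [Nat.card_eq_fintype_card]; omega) hp
  have h5t : MulAction.IsMultiplyPretransitive G α 5 := by
    have := hm.isMultiplyPretransitive
    exact MulAction.isMultiplyPretransitive_of_le (n := Fintype.card α - 6 + 2) (by omega)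
      (by rw [Nat.card_eq_fintype_card]; omega)
  obtain ⟨S, hS, hS5⟩ : ∃ S : Finset α, g.support ∩ S = ∅ ∧ S.card = 4 := by
    obtain ⟨S, hS, hS4⟩ := Finset.exists_subset_card_eq (s := g.supportᶜ) (n := 4)
      (by rw [Finset.card_compl]; omega)
    refine ⟨S, ?_, hS4⟩
    rw [← Finset.disjoint_iff_inter_eq_empty]
    exact Finset.subset_compl_iff_disjoint_left.mp hS
  obtain ⟨a, ha⟩ : g.support.Nonempty := Finset.card_pos.mp (by omega)
  have haS : a ∉ S := fun h => by
    have : a ∈ g.support ∩ S := Finset.mem_inter.mpr ⟨ha, h⟩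
    simp [hS] at this
  have hT : (insert a S).card = 5 := by rw [Finset.card_insert_of_notMem haS, hS5]
  let e1 := (g.support.equivFinOfCardEq h5).symm
  let e2 := ((insert a S).equivFinOfCardEq hT).symm
  obtain ⟨σ, hσ⟩ := MulAction.exists_smul_eq (M := G)
    (e1.toEmbedding.trans (Function.Embedding.subtype _))
        (e2.toEmbedding.trans (Function.Embedding.subtype _))
  have hσ' : ∀ i, (σ : Perm α) (e1 i) = e2 i := fun i => DFunLike.congr_fun hσ i
  have himg : (σ * g * (σ : Perm α)⁻¹).support = insert a S := by
    rw [Perm.support_conj]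
    ext z
    simp only [Finset.mem_map, Equiv.coe_toEmbedding]
    constructor
    · rintro ⟨w, hw, rfl⟩
      have := hσ' (e1.symm ⟨w, hw⟩)
      simp at this
      rw [this]; exact (e2 _).2
    · intro hz
      have := hσ' (e2.symm ⟨z, hz⟩)
      simp at this
      exact ⟨_, (e1 _).2, this⟩
  have hh : (σ : Perm α) * g * (σ : Perm α)⁻¹ ∈ G :=
    G.mul_mem (G.mul_mem σ.2 hg) (G.inv_mem σ.2)
  refine ⟨_, G.mul_mem (G.mul_mem (G.mul_mem hg hh) (G.inv_mem hg)) (G.inv_mem hh),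
    isThreeCycle_commutator_of_support_inter g _ a ?_⟩
  rw [himg, Finset.inter_insert_of_mem ha, hS, insert_empty_eq]
end

section
variable {α : Type*} [DecidableEq α] [Fintype α]

theorem mul_mul_mul_apply_eq_self {g h : Perm α} {C : Finset α} (hg : ∀ z, g (g z) = z)
    (hh : ∀ z, h (h z) = z) (hC : g.support ∩ h.support = C) {w : α} (h0 : w ∉ C) (h1 : g w ∉ C)
    (h2 : h w ∉ C) : g (h (g (h w))) = w := by
  have key : ∀ z ∉ C, g z ≠ z → h z = z := by
    intro z hz a
    by_contra b
    exact hz (hC ▸ by simp [a, b])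
  by_cases a : h w = w
  · by_cases b : g w = w
    · rw [a, b, a, b]
    · rw [a, key _ h1 (fun q => b (by rw [hg] at q; exact q.symm)), hg]
  · have b : g w = w := by
      by_contra b; exact a (key _ h0 b)
    have c : g (h w) = h w := by
      by_contra c
      exact a (by have := key _ h2 c; rw [hh] at this; exact this.symm)
    rw [c, hh, b]

theorem card_support_of_inter_pair_edge {g h : Perm α} (hg : ∀ z, g (g z) = z)
    (hh : ∀ z, h (h z) = z) {x y : α} (hxy : g.support ∩ h.support = {x, y}) (hne : x ≠ y)
    (h1 : g x = y) (h2 : h x ≠ y) : (g * h * (g * h)).support.card = 4 := by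
  have key : ∀ z, h z ≠ z → z ≠ x → z ≠ y → g z = z := by
    intro z a b c
    by_contra d
    have : z ∈ g.support ∩ h.support := by simp [a, d]
    simp [hxy, b, c] at this
  have hx : x ∈ g.support ∩ h.support := by simp [hxy]
  have hy : y ∈ g.support ∩ h.support := by simp [hxy]
  simp only [Finset.mem_inter, Perm.mem_support] at hx hy
  obtain ⟨gx, hx⟩ := hx
  obtain ⟨gy, hy⟩ := hy
  have h3 : g y = x := by rw [← h1, hg]
  obtain ⟨a, ha⟩ : ∃ a, a = h x := ⟨_, rfl⟩
  obtain ⟨b, hb⟩ : ∃ b, b = h y := ⟨_, rfl⟩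
  rw [← ha] at h2 hx
  rw [← hb] at hy
  have ha' : h a = x := by rw [ha, hh]
  have hb' : h b = y := by rw [hb, hh]
  have hbx : b ≠ x := by rintro rfl; exact h2 (ha.trans hb')
  have hab : a ≠ b := by rintro rfl; exact hne (ha'.symm.trans hb')
  have ga : g a = a := key a (by rw [ha']; exact hx.symm) hx h2
  have gb : g b = b := key b (by rw [hb']; exact hy.symm) hbx hy
  have e : (g * h * (g * h)).support = {x, y, a, b} := by
    ext z
    simp only [Perm.mem_support, Perm.mul_apply, Finset.mem_insert, Finset.mem_singleton]
    by_cases z1 : z = x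
    · rw [z1, ← ha, ga, ha', h1]; simp [hne.symm]
    by_cases z2 : z = y
    · rw [z2, ← hb, gb, hb', h3]; simp [hne]
    by_cases z3 : z = a
    · rw [z3, ha', h1, ← hb, gb]; simp [hab.symm]
    by_cases z4 : z = b
    · rw [z4, hb', h3, ← ha, ga]; simp [hab]
    rw [mul_mul_mul_apply_eq_self hg hh hxy]
    · simp [z1, z2, z3, z4]
    · simp [z1, z2]
    · simp only [Finset.mem_insert, Finset.mem_singleton]; grind
    · simp only [Finset.mem_insert, Finset.mem_singleton]; grind
  rw [e, Finset.card_insert_of_notMem, Finset.card_insert_of_notMem, Finset.card_insert_of_notMem,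
    Finset.card_singleton]
  · simpa using hab
  · simpa using ⟨h2.symm, hy.symm⟩
  · simpa using ⟨hne, hx.symm, hbx.symm⟩

theorem card_support_of_inter_pair_not_edge {g h : Perm α} (hg : ∀ z, g (g z) = z)
    (hh : ∀ z, h (h z) = z) (hgc : g.support.card = 6) (hhc : h.support.card = 6)
    {x y : α} (hxy : g.support ∩ h.support = {x, y}) (hne : x ≠ y)
    (h1 : g x ≠ y) (h2 : h x ≠ y) : (g * h * (g * h * (g * h))).support.card = 4 := by
  have key : ∀ z, z ≠ x → z ≠ y → g z = z ∨ h z = z := by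
    intro z b c
    by_contra! d
    have : z ∈ g.support ∩ h.support := by simp [d]
    simp [hxy, b, c] at this
  have hx : x ∈ g.support ∩ h.support := by simp [hxy]
  have hy : y ∈ g.support ∩ h.support := by simp [hxy]
  simp only [Finset.mem_inter, Perm.mem_support] at hx hy
  obtain ⟨gx, hx⟩ := hx
  obtain ⟨gy, hy⟩ := hy
  have hgy : g y ≠ x := by intro q; rw [← q, hg] at h1; exact h1 rfl
  have hhy : h y ≠ x := by intro q; rw [← q, hh] at h2; exact h2 rfl
  have cube : ∀ {z}, z ≠ x → z ≠ y → (h (g x) = g x) → (g (h x) = h x) → h (g y) = g y →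
      g (h y) = h y → ((g (h (g (h (g (h z))))) ≠ z) ↔
      (g z ≠ z ∧ ¬ (z = x ∨ z = y ∨ z = g x ∨ z = g y)) ∨
      (h z ≠ z ∧ ¬ (z = x ∨ z = y ∨ z = h x ∨ z = h y))) := by
    intro z z1 z2 k1 k2 k3 k4
    by_cases z3 : z = g x
    · have : h z = z := by rw [z3, k1]
      rw [this, z3, hg, k2, hh]; simp
    by_cases z4 : z = g y
    · have : h z = z := by rw [z4, k3]
      rw [this, z4, hg, k4, hh]; simp
    by_cases z5 : z = h x
    · rw [z5, hh, k1, hg, k2]; simp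
    by_cases z6 : z = h y
    · rw [z6, hh, k3, hg, k4]; simp
    rw [mul_mul_mul_apply_eq_self hg hh hxy]
    · simp only [z1, z2, z3, z4, z5, z6, or_self, not_false_eq_true, and_true]
      rcases key z z1 z2 with k | k
      · have : g (h z) = h z := by
          by_contra q
          rcases key (h z) (by grind) (by grind) with r | r
          · exact q r
          · rw [hh] at r; exact q (by rw [← r, k])
        rw [this]; simp [k]
      · rw [k]; simp
    · grind
    · simp only [Finset.mem_insert, Finset.mem_singleton]; grind
    · simp only [Finset.mem_insert, Finset.mem_singleton]; grind
  have k1 : h (g x) = g x := (key (g x) gx h1).resolve_left (by rw [hg]; exact gx.symm)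
  have k3 : h (g y) = g y := (key (g y) hgy gy).resolve_left (by rw [hg]; exact gy.symm)
  have k2 : g (h x) = h x := (key (h x) hx h2).resolve_right (by rw [hh]; exact hx.symm)
  have k4 : g (h y) = h y := (key (h y) hhy hy).resolve_right (by rw [hh]; exact hy.symm)
  have e : (g * h * (g * h * (g * h))).support =
      (g.support \ {x, y, g x, g y}) ∪ (h.support \ {x, y, h x, h y}) := by
    ext z
    simp only [Perm.mem_support, Perm.mul_apply, Finset.mem_insert, Finset.mem_singleton,
      Finset.mem_union, Finset.mem_sdiff]
    by_cases z1 : z = x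
    · rw [z1, k2, hh, k1, hg]; simp
    by_cases z2 : z = y
    · rw [z2, k4, hh, k3, hg]; simp
    exact cube z1 z2 k1 k2 k3 k4
  have c : ∀ k : Perm α, (∀ z, k (k z) = z) → k x ≠ x → k y ≠ y → k x ≠ y →
      k.support.card = 6 → (k.support \ {x, y, k x, k y}).card = 2 := by
    intro k hk a1 a2 a3 a6
    have a4 : k x ≠ k y := fun q => hne (k.injective q)
    have a5 : k y ≠ x := by grind
    rw [Finset.card_sdiff_of_subset, a6]
    · rw [Finset.card_insert_of_notMem, Finset.card_insert_of_notMem, Finset.card_insert_of_notMem,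
        Finset.card_singleton]
      all_goals simp; try grind
    · intro z; simp; grind
  rw [e, Finset.card_union_of_disjoint, c g hg gx gy h1 hgc, c h hh hx hy h2 hhc]
  rw [Finset.disjoint_left]
  intro z
  have := key z
  simp only [Finset.mem_sdiff, Perm.mem_support, Finset.mem_insert, Finset.mem_singleton]
  tauto

theorem card_support_of_inter_triple_isolated {g h : Perm α} (hg : ∀ z, g (g z) = z)
    (hh : ∀ z, h (h z) = z) {x y z : α} (hgx : g x = y) (hC : g.support ∩ h.support = {x, y, z})
    (hne : x ≠ z) (hne' : y ≠ z) (h2 : h x ≠ y) (h3 : h x ≠ z) (h4 : h y ≠ z) :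
    (g * h * (g * h) * (g * h * (g * h))).support.card = 3 := by
  have key : ∀ w, w ≠ x → w ≠ y → w ≠ z → g w = w ∨ h w = w := by
    intro w b c e
    by_contra! d
    have : w ∈ g.support ∩ h.support := by simp [d]
    simp [hC, b, c, e] at this
  have hx : x ∈ g.support ∩ h.support := by simp [hC]
  have hy : y ∈ g.support ∩ h.support := by simp [hC]
  have hz : z ∈ g.support ∩ h.support := by simp [hC]
  simp only [Finset.mem_inter, Perm.mem_support] at hx hy hz
  obtain ⟨gx, hx⟩ := hx
  obtain ⟨gy, hy⟩ := hy
  obtain ⟨gz, hz⟩ := hz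
  have hgy : g y = x := by rw [← hgx, hg]
  obtain ⟨a, ha⟩ : ∃ a, a = h x := ⟨_, rfl⟩
  obtain ⟨b, hb⟩ : ∃ b, b = h y := ⟨_, rfl⟩
  obtain ⟨c, hc⟩ : ∃ c, c = h z := ⟨_, rfl⟩
  obtain ⟨d, hd⟩ : ∃ d, d = g z := ⟨_, rfl⟩
  rw [← ha] at h2 h3 hx
  rw [← hb] at h4 hy
  rw [← hc] at hz
  rw [← hd] at gz
  have ha' : h a = x := by rw [ha, hh]
  have hb' : h b = y := by rw [hb, hh]
  have hc' : h c = z := by rw [hc, hh]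
  have hd' : g d = z := by rw [hd, hg]
  have hxy : x ≠ y := by rintro rfl; exact gx hgx
  have hbx : b ≠ x := by rintro rfl; exact h2 (ha.trans hb')
  have hcx : c ≠ x := by rintro rfl; exact h3 (ha.trans hc')
  have hcy : c ≠ y := by rintro rfl; exact h4 (hb.trans hc')
  have hdx : d ≠ x := by rintro rfl; exact hne' (hgx.symm.trans hd')
  have hdy : d ≠ y := by rintro rfl; exact hne (hgy.symm.trans hd')
  have hab : a ≠ b := by rintro rfl; exact hxy (ha'.symm.trans hb')
  have hac : a ≠ c := by rintro rfl; exact hne (ha'.symm.trans hc')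
  have hbc : b ≠ c := by rintro rfl; exact hne' (hb'.symm.trans hc')
  have ga : g a = a := (key a hx h2 h3).resolve_right (by rw [ha']; exact hx.symm)
  have gb : g b = b := (key b hbx hy h4).resolve_right (by rw [hb']; exact hy.symm)
  have gc : g c = c := (key c hcx hcy hz).resolve_right (by rw [hc']; exact hz.symm)
  have kd : h d = d := (key d hdx hdy gz).resolve_left (by rw [hd']; exact gz.symm)
  have hdc : d ≠ c := by rintro rfl; exact gz (gc.symm.trans hd')
  have e : (g * h * (g * h) * (g * h * (g * h))).support = {z, d, c} := by
    ext w
    simp only [Perm.mem_support, Perm.mul_apply, Finset.mem_insert, Finset.mem_singleton]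
    by_cases w1 : w = x
    · rw [w1, ← ha, ga, ha', hgx, ← hb, gb, hb', hgy]; grind
    by_cases w2 : w = y
    · rw [w2, ← hb, gb, hb', hgy, ← ha, ga, ha', hgx]; grind
    by_cases w3 : w = a
    · rw [w3, ha', hgx, ← hb, gb, hb', hgy, ← ha, ga]; grind
    by_cases w4 : w = b
    · rw [w4, hb', hgy, ← ha, ga, ha', hgx, ← hb, gb]; grind
    by_cases w5 : w = z
    · rw [w5, ← hc, gc, hc', ← hd, kd, hd', ← hc, gc]; simp [hz]
    by_cases w6 : w = d
    · rw [w6, kd, hd', ← hc, gc, hc', ← hd, kd, hd']; simp [gz.symm]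
    by_cases w7 : w = c
    · rw [w7, hc', ← hd, kd, hd', ← hc, gc, hc', ← hd]; simp [hdc]
    have k := mul_mul_mul_apply_eq_self (w := w) hg hh hC (by simp [w1, w2, w5])
      (by simp only [Finset.mem_insert, Finset.mem_singleton]; grind)
      (by simp only [Finset.mem_insert, Finset.mem_singleton]; grind)
    rw [k, k]; simp [w5, w6, w7]
  rw [e, Finset.card_insert_of_notMem, Finset.card_insert_of_notMem, Finset.card_singleton]
  · simpa using hdc
  · simpa using ⟨gz.symm, hz.symm⟩

theorem isCycle_of_inter_triple_path {g h : Perm α} (hg : ∀ z, g (g z) = z)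
    (hh : ∀ z, h (h z) = z) {x y z : α} (h1 : g x = y) (h2 : h x = z)
    (hC : g.support ∩ h.support = {x, y, z}) (hyz : y ≠ z) :
    (g * h * (g * h)).IsCycle ∧ (g * h * (g * h)).support.card = 5 := by
  have key : ∀ w, w ≠ x → w ≠ y → w ≠ z → g w = w ∨ h w = w := by
    intro w b c e
    by_contra! d
    have : w ∈ g.support ∩ h.support := by simp [d]
    simp [hC, b, c, e] at this
  have hx : x ∈ g.support ∩ h.support := by simp [hC]
  have hy : y ∈ g.support ∩ h.support := by simp [hC]
  have hz : z ∈ g.support ∩ h.support := by simp [hC]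
  simp only [Finset.mem_inter, Perm.mem_support] at hx hy hz
  obtain ⟨gx, hx⟩ := hx
  obtain ⟨gy, hy⟩ := hy
  obtain ⟨gz, hz⟩ := hz
  have hgy : g y = x := by rw [← h1, hg]
  have hhz : h z = x := by rw [← h2, hh]
  obtain ⟨b, hb⟩ : ∃ b, b = h y := ⟨_, rfl⟩
  obtain ⟨d, hd⟩ : ∃ d, d = g z := ⟨_, rfl⟩
  rw [← hb] at hy
  rw [← hd] at gz
  have hb' : h b = y := by rw [hb, hh]
  have hd' : g d = z := by rw [hd, hg]
  have hxy : x ≠ y := by rintro rfl; exact gx h1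
  have hxz : x ≠ z := by rintro rfl; exact hx h2
  have l1 : b ≠ x := by rintro rfl; exact hyz (hb'.symm.trans h2)
  have l2 : b ≠ z := by rintro rfl; exact hxy (hhz.symm.trans hb')
  have l3 : d ≠ x := by rintro rfl; exact hyz (h1.symm.trans hd')
  have l4 : d ≠ y := by rintro rfl; exact hxz (hgy.symm.trans hd')
  have gb : g b = b := (key b l1 hy l2).resolve_right (by rw [hb']; exact hy.symm)
  have kd : h d = d := (key d l3 l4 gz).resolve_left (by rw [hd']; exact gz.symm)
  have l5 : d ≠ b := by rintro rfl; exact l2 (gb.symm.trans hd')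
  set k := g * h * (g * h) with hk
  have e1 : k x = z := by simp only [hk, Perm.mul_apply, h2, ← hd, kd, hd']
  have e2 : k z = b := by simp only [hk, Perm.mul_apply, hhz, h1, ← hb, gb]
  have e3 : k b = d := by simp only [hk, Perm.mul_apply, hb', hgy, h2, ← hd]
  have e4 : k d = y := by simp only [hk, Perm.mul_apply, kd, hd', hhz, h1]
  have e5 : k y = x := by simp only [hk, Perm.mul_apply, ← hb, gb, hb', hgy]
  have e6 : ∀ w, w ≠ x → w ≠ y → w ≠ z → w ≠ b → w ≠ d → k w = w := by
    intro w w1 w2 w3 w4 w5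
    refine mul_mul_mul_apply_eq_self hg hh hC (by simp [w1, w2, w3]) ?_ ?_
    · simp only [Finset.mem_insert, Finset.mem_singleton]; grind
    · simp only [Finset.mem_insert, Finset.mem_singleton]; grind
  have cyc : ∀ w, k w ≠ w → w = x ∨ w = y ∨ w = z ∨ w = b ∨ w = d := by
    intro w hw
    by_contra! q
    exact hw (e6 w q.1 q.2.1 q.2.2.1 q.2.2.2.1 q.2.2.2.2)
  clear_value k
  constructor
  · refine ⟨x, by rw [e1]; exact hxz.symm, fun w hw => ?_⟩
    rcases cyc w hw with r | r | r | r | r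
    · exact ⟨(0 : ℕ), by rw [r]; rfl⟩
    · exact ⟨(4 : ℕ), by rw [zpow_natCast, r]; simp only [
        pow_succ, pow_zero, one_mul, Perm.mul_apply, e1, e2, e3, e4]⟩
    · exact ⟨(1 : ℕ), by rw [zpow_natCast, r]; simp only [pow_succ, pow_zero, one_mul, e1]⟩
    · exact ⟨(2 : ℕ), by rw [zpow_natCast, r]; simp only [
        pow_succ, pow_zero, one_mul, Perm.mul_apply, e1, e2]⟩
    · exact ⟨(3 : ℕ), by rw [zpow_natCast, r]; simp only [
        pow_succ, pow_zero, one_mul, Perm.mul_apply, e1, e2, e3]⟩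
  · have e : k.support = {x, y, z, b, d} := by
      ext w
      simp only [Perm.mem_support, Finset.mem_insert, Finset.mem_singleton]
      refine ⟨cyc w, ?_⟩
      rintro (rfl | rfl | rfl | rfl | rfl)
      · rw [e1]; exact hxz.symm
      · rw [e5]; exact hxy
      · rw [e2]; exact l2
      · rw [e3]; exact l5
      · rw [e4]; exact l4.symm
    rw [e, Finset.card_insert_of_notMem, Finset.card_insert_of_notMem, Finset.card_insert_of_notMem,
      Finset.card_insert_of_notMem, Finset.card_singleton]
    · simpa using l5.symm
    · simpa using ⟨l2.symm, gz.symm⟩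
    · simpa using ⟨hyz, hy.symm, l4.symm⟩
    · simpa using ⟨hxy, hxz, l1.symm, l3.symm⟩
end

section
variable {α : Type*} [DecidableEq α] [Fintype α]

theorem apply_eq_of_inter_card_three {G : Subgroup (Perm α)} (h2 : TwoTrans G)
    (hα : 10 ≤ Fintype.card α) (hno : ∀ c ∈ G, ¬ c.IsThreeCycle) {g h : Perm α} (hgG : g ∈ G)
    (hhG : h ∈ G) (hg : ∀ z, g (g z) = z) (hh : ∀ z, h (h z) = z)
    (h3 : (g.support ∩ h.support).card = 3) {c : α} (hc : c ∈ g.support ∩ h.support)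
    (hgc : g c ∈ g.support ∩ h.support) : g c = h c := by
  have hne : g c ≠ c := by simp at hc; exact hc.1
  have h1 : (((g.support ∩ h.support).erase c).erase (g c)).card = 1 := by
    rw [Finset.card_erase_of_mem (Finset.mem_erase.mpr ⟨hne, hgc⟩), Finset.card_erase_of_mem hc, h3]
  obtain ⟨z, hz⟩ := Finset.card_eq_one.mp h1
  have hC : g.support ∩ h.support = {c, g c, z} := by
    rw [← hz, Finset.insert_erase (Finset.mem_erase.mpr ⟨hne, hgc⟩), Finset.insert_erase hc]
  have hz' : z ∈ ((g.support ∩ h.support).erase c).erase (g c) := by simp [hz]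
  simp only [Finset.mem_erase] at hz'
  have hgh : g * h * (g * h) ∈ G := G.mul_mem (G.mul_mem hgG hhG) (G.mul_mem hgG hhG)
  by_contra q
  by_cases a : h c = z
  · obtain ⟨i1, i2⟩ := isCycle_of_inter_triple_path hg hh rfl a hC hz'.1.symm
    obtain ⟨t, ht, ht'⟩ := exists_isThreeCycle_of_five_cycle h2 hgh i1 i2 hα
    exact hno t ht ht'
  by_cases b : h (g c) = z
  · obtain ⟨i1, i2⟩ := isCycle_of_inter_triple_path hg hh (hg c) b
      (by rw [hC, Finset.insert_comm]) hz'.2.1.symm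
    obtain ⟨t, ht, ht'⟩ := exists_isThreeCycle_of_five_cycle h2 hgh i1 i2 hα
    exact hno t ht ht'
  have i := card_support_of_inter_triple_isolated hg hh rfl hC hz'.2.1.symm hz'.1.symm
    (Ne.symm q) a b
  obtain ⟨t, ht, ht'⟩ := exists_isThreeCycle_of_card_support h2 (G.mul_mem hgh hgh) i.ge
    (by rw [i]; omega)
  exact hno t ht ht'

theorem inter_inequality {G : Subgroup (Perm α)} (h2 : TwoTrans G)
    (hα : 10 ≤ Fintype.card α) (hno : ∀ c ∈ G, ¬ c.IsThreeCycle) {g h : Perm α} (hgG : g ∈ G)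
    (hhG : h ∈ G) (hg : ∀ z, g (g z) = z) (hh : ∀ z, h (h z) = z)
    (hgc : g.support.card = 6) (hhc : h.support.card = 6) {C : Finset α}
    (hC : g.support ∩ h.support = C) :
    4 * C.card + (C.filter fun c => g c ∈ C).card + (C.filter fun c => h c ∈ C).card ≤
      2 * (C.card * C.card - C.card) + 4 * (C.filter fun c => g c = h c).card := by
  have hP : (C.filter fun c => g c ∈ C).card ≤ C.card := Finset.card_filter_le _ _
  have hQ : (C.filter fun c => h c ∈ C).card ≤ C.card := Finset.card_filter_le _ _
  have bad : ∀ k ∈ G, k.support.card = 4 → False := by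
    intro k hk hk4
    obtain ⟨t, ht, ht'⟩ := exists_isThreeCycle_of_card_support h2 hk (by omega) (by rw [hk4]; omega)
    exact hno t ht ht'
  rcases Nat.lt_or_ge 3 C.card with h4 | h4
  · have : C.card * 4 ≤ C.card * C.card := Nat.mul_le_mul_left _ h4
    omega
  interval_cases hX : C.card
  · omega
  · obtain ⟨c, hc⟩ := Finset.card_eq_one.mp hX
    exact absurd (isThreeCycle_commutator_of_support_inter g h c (hC.trans hc))
      (hno _ (G.mul_mem (G.mul_mem (G.mul_mem hgG hhG) (G.inv_mem hgG)) (G.inv_mem hhG)))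
  · obtain ⟨x, y, hxy, hc⟩ := Finset.card_eq_two.mp hX
    have hCg := hC.trans hc
    have hCh : h.support ∩ g.support = {x, y} := by rw [Finset.inter_comm, hCg]
    have hgh : g x = y ∧ h x = y := by
      by_cases a : g x = y
      · by_cases b : h x = y
        · exact ⟨a, b⟩
        · exact (bad _ (G.mul_mem (G.mul_mem hgG hhG) (G.mul_mem hgG hhG))
            (card_support_of_inter_pair_edge hg hh hCg hxy a b)).elim
      · by_cases b : h x = y
        · exact (bad _ (G.mul_mem (G.mul_mem hhG hgG) (G.mul_mem hhG hgG))
            (card_support_of_inter_pair_edge hh hg hCh hxy b a)).elim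
        · exact (bad _ (G.mul_mem (G.mul_mem hgG hhG)
            (G.mul_mem (G.mul_mem hgG hhG) (G.mul_mem hgG hhG)))
            (card_support_of_inter_pair_not_edge hg hh hgc hhc hCg hxy a b)).elim
    have : (C.filter fun c => g c = h c) = C := by
      apply Finset.filter_true_of_mem
      intro c hc'
      rw [hc, Finset.mem_insert, Finset.mem_singleton] at hc'
      rcases hc' with rfl | rfl
      · rw [hgh.1, hgh.2]
      · rw [← hgh.1, hg, hgh.1, ← hgh.2, hh]
    rw [this, hX]
    omega
  · have two : ∀ c ∈ C, g c ∈ C → g c ≠ c → g c = h c → 2 ≤ (C.filter fun c => g c = h c).card := by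
      intro c hc hc' hne q
      rw [← Finset.card_pair hne.symm]
      apply Finset.card_le_card
      intro z hz
      rw [Finset.mem_insert, Finset.mem_singleton] at hz
      rcases hz with rfl | rfl
      · simp [hc, q]
      · simp only [Finset.mem_filter, hc', true_and, hg]
        rw [q, hh]
    have hXg : (g.support ∩ h.support).card = 3 := by rw [hC, hX]
    have hXh : (h.support ∩ g.support).card = 3 := by rw [Finset.inter_comm, hC, hX]
    have hCh : h.support ∩ g.support = C := by rw [Finset.inter_comm, hC]
    have ne : ∀ c ∈ C, g c ≠ c ∧ h c ≠ c := by
      intro c hc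
      rw [← hC] at hc
      simpa using hc
    by_cases p : ∃ c ∈ C, g c ∈ C
    · obtain ⟨c, hc, hc'⟩ := p
      have := two c hc hc' (ne c hc).1 (apply_eq_of_inter_card_three h2 hα hno hgG hhG hg hh hXg
        (hC ▸ hc) (hC ▸ hc'))
      omega
    by_cases q : ∃ c ∈ C, h c ∈ C
    · obtain ⟨c, hc, hc'⟩ := q
      have e := apply_eq_of_inter_card_three h2 hα hno hhG hgG hh hg hXh
        (hCh ▸ hc) (hCh ▸ hc')
      have := two c hc (e ▸ hc') (ne c hc).1 e.symm
      omega
    push Not at p q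
    rw [Finset.filter_false_of_mem p, Finset.filter_false_of_mem q]
    simp

theorem exists_isThreeCycle_of_involution {G : Subgroup (Perm α)} (h2 : TwoTrans G)
    (hα : 12 ≤ Fintype.card α) {g : Perm α} (hgG : g ∈ G) (hg : ∀ z, g (g z) = z)
    (h6 : g.support.card = 6) : ∃ c ∈ G, c.IsThreeCycle := by
  classical
  by_contra! hno
  obtain ⟨K, hK, hcount⟩ := h2.exists_pairCount
  obtain ⟨hpt, hpr⟩ := hcount.sum_common g.support
  set S := g.support with hS
  have hgS : ∀ c, c ∈ S → g c ∈ S := fun c hc => by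
    rw [hS] at hc ⊢
    exact Perm.apply_mem_support.mpr hc
  let ed : Finset (α × α) := S.image fun c => (c, g c)
  have hed : ∀ p, p ∈ ed ↔ p.1 ∈ S ∧ p.2 = g p.1 := by
    rintro ⟨a, b⟩
    simp only [ed, Finset.mem_image, Prod.mk.injEq]
    exact ⟨by rintro ⟨c, hc, rfl, rfl⟩; exact ⟨hc, rfl⟩,
      by rintro ⟨hc, rfl⟩; exact ⟨a, hc, rfl, rfl⟩⟩
  have hedne : ∀ p ∈ ed, p.1 ≠ p.2 := by
    intro p hp
    rw [hed] at hp
    rw [hp.2]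
    have := hp.1
    rw [hS, Perm.mem_support] at this
    exact this.symm
  have hedc : ed.card = 6 := by
    rw [Finset.card_image_of_injective, h6]
    intro a b hab
    exact (Prod.mk.injEq _ _ _ _ ▸ hab).1
  have hoff : ∀ p ∈ S.offDiag, p.1 ≠ p.2 := by simp
  have hoffc : S.offDiag.card = 30 := by rw [Finset.offDiag_card, h6]
  have cP := hcount S.offDiag ed hoff hedne
  have cQ := hcount ed S.offDiag hedne hoff
  have cE := hcount ed ed hedne hedne
  rw [hedc, hoffc] at cP cQ
  rw [hedc] at cE
  rw [h6] at hpt hpr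
  have inj : Function.Injective fun c => (c, g c) := fun a b hab => (Prod.mk.injEq _ _ _ _ ▸ hab).1
  let H : G → Perm α := fun σ => σ * g * (σ : Perm α)⁻¹
  have mem_common : ∀ (σ : G) c, c ∈ common S σ ↔ c ∈ S ∧ (σ : Perm α)⁻¹ c ∈ S := by
    intro σ c; simp [common]
  have fP : ∀ σ : G, (ed.filter fun q => ((σ : Perm α)⁻¹ q.1, (σ : Perm α)⁻¹ q.2) ∈
      S.offDiag).card =
      ((common S σ).filter fun c => g c ∈ common S σ).card := by
    intro σ
    rw [← Finset.card_image_of_injective _ inj]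
    congr 1
    ext ⟨a, b⟩
    have := hedne (a, b)
    simp only [Finset.mem_filter, hed, Finset.mem_offDiag, Finset.mem_image, mem_common, ne_eq,
      EmbeddingLike.apply_eq_iff_eq, Prod.mk.injEq] at this ⊢
    have := hgS a
    grind
  have fQ : ∀ σ : G, (S.offDiag.filter fun q => ((σ : Perm α)⁻¹ q.1, (σ : Perm α)⁻¹ q.2) ∈
      ed).card =
      ((common S σ).filter fun c => H σ c ∈ common S σ).card := by
    intro σ
    have inj : Function.Injective fun c => (c, H σ c) := fun a b hab =>
        (Prod.mk.injEq _ _ _ _ ▸ hab).1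
    rw [← Finset.card_image_of_injective _ inj]
    congr 1
    ext ⟨a, b⟩
    have h0 : b = H σ a ↔ (σ : Perm α)⁻¹ b = g ((σ : Perm α)⁻¹ a) := by
      simp only [H, Perm.mul_apply, Perm.inv_eq_iff_eq]
    have h1 := hedne ((σ : Perm α)⁻¹ a, (σ : Perm α)⁻¹ b)
    have := hgS ((σ : Perm α)⁻¹ a)
    simp only [Finset.mem_filter, hed, Finset.mem_offDiag, Finset.mem_image, mem_common, ne_eq,
      EmbeddingLike.apply_eq_iff_eq, Prod.mk.injEq] at h1 ⊢
    grind
  have fE : ∀ σ : G, (ed.filter fun q => ((σ : Perm α)⁻¹ q.1, (σ : Perm α)⁻¹ q.2) ∈ ed).card =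
      ((common S σ).filter fun c => g c = H σ c).card := by
    intro σ
    rw [← Finset.card_image_of_injective _ inj]
    congr 1
    ext ⟨a, b⟩
    have h0 : b = H σ a ↔ (σ : Perm α)⁻¹ b = g ((σ : Perm α)⁻¹ a) := by
      simp only [H, Perm.mul_apply, Perm.inv_eq_iff_eq]
    simp only [Finset.mem_filter, hed, Finset.mem_image, mem_common, Prod.mk.injEq]
    grind
  simp only [fP] at cP
  simp only [fQ] at cQ
  simp only [fE] at cE
  have hHG : ∀ σ, H σ ∈ G := fun σ => G.mul_mem (G.mul_mem σ.2 hgG) (G.inv_mem σ.2)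
  have hHH : ∀ σ z, H σ (H σ z) = z := by intro σ z; simp [H, hg]
  have hHc : ∀ σ, (H σ).support.card = 6 := by
    intro σ
    simp only [H, Perm.support_conj, Finset.card_map]
    exact h6
  have hlt := Finset.sum_lt_sum (s := Finset.univ) (fun σ _ => inter_inequality h2 (by omega)
      hno hgG
    (hHG σ) hg (hHH σ) h6 (hHc σ) (common_support g σ).symm) ⟨1, Finset.mem_univ _, by
      have h1 : common g.support ((1 : G) : Perm α) = S := by
        ext c; simp [common, ← hS]
      have h3 : H 1 = g := by simp [H]
      rw [h1, h3, Finset.filter_true_of_mem hgS, Finset.filter_true_of_mem (fun _ _ => rfl), h6]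
      norm_num⟩
  simp only [Finset.sum_add_distrib, ← Finset.mul_sum, ← hS] at hlt
  rw [cP, cQ, cE] at hlt
  obtain ⟨m, hm⟩ : ∃ m, Fintype.card α = m + 1 := ⟨Fintype.card α - 1, by omega⟩
  rw [hm] at hpt hα
  simp only [Nat.add_sub_cancel] at hpt
  have hX : ∑ σ : G, (common S σ).card = K * 36 * m := by
    have : (∑ σ : G, (common S σ).card) * m = K * 36 * m * m := by
      exact Eq.trans (by congr!) (hpt.trans (by ring))
    exact Nat.eq_of_mul_eq_mul_right (by omega) this
  replace hpr : ∑ σ : G, ((common S σ).card * (common S σ).card - (common S σ).card) = K * 900 := by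
    convert hpr
  rw [hX, hpr] at hlt
  have : K * 11 ≤ K * m := Nat.mul_le_mul_left _ (by omega)
  nlinarith
end

section
variable {α : Type*} [DecidableEq α] [Fintype α]

theorem card_support_swap_mul_swap_mul_swap {a b c p q : α} (hab : a ≠ b) (hac : a ≠ c)
    (hbc : b ≠ c) (hpq : p ≠ q) {g : Perm α} (hg : g = swap a b * swap a c * swap p q) :
    g.support.card = 2 ∨ (g ^ 3).support.card = 2 ∨ g.support.card = 4 := by
  have hsub : ∀ z, z ≠ a → z ≠ b → z ≠ c → z ≠ p → z ≠ q → g z = z := by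
    intro z z1 z2 z3 z4 z5
    rw [hg, Perm.mul_apply, Perm.mul_apply, swap_apply_of_ne_of_ne z4 z5,
      swap_apply_of_ne_of_ne z1 z3, swap_apply_of_ne_of_ne z1 z2]
  have hsign : Perm.sign g = -1 := by
    rw [hg, Perm.sign_mul, Perm.sign_mul, Perm.sign_swap hab, Perm.sign_swap hac,
      Perm.sign_swap hpq]; rfl
  have small : ∀ r, (∀ z, z ≠ a → z ≠ b → z ≠ c → z ≠ r → g z = z) →
      g.support.card = 2 ∨ (g ^ 3).support.card = 2 ∨ g.support.card = 4 := by
    intro r hr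
    have h4 : g.support.card ≤ 4 := by
      refine (Finset.card_le_card (t := {a, b, c, r}) fun z hz => ?_).trans Finset.card_le_four
      simp only [Finset.mem_insert, Finset.mem_singleton]
      by_contra! h
      exact (Perm.mem_support.mp hz) (hr z h.1 h.2.1 h.2.2.1 h.2.2.2)
    have h0 : g.support.card ≠ 0 := by
      rw [Ne, Perm.card_support_eq_zero]; intro h
      rw [h, Perm.sign_one] at hsign; exact absurd hsign (by decide)
    have h1 := Perm.card_support_ne_one g
    have h3 : g.support.card ≠ 3 := by
      rw [Ne, card_support_eq_three_iff]
      intro h; rw [h.sign] at hsign; exact absurd hsign (by decide)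
    omega
  by_cases hp : p = a ∨ p = b ∨ p = c
  · refine small q fun z z1 z2 z3 z4 => hsub z z1 z2 z3 ?_ z4
    rcases hp with rfl | rfl | rfl <;> assumption
  by_cases hq : q = a ∨ q = b ∨ q = c
  · refine small p fun z z1 z2 z3 z4 => hsub z z1 z2 z3 z4 ?_
    rcases hq with rfl | rfl | rfl <;> assumption
  right; left
  have ht := Perm.isThreeCycle_swap_mul_swap_same hab hac hbc
  have hd : Perm.Disjoint (swap a b * swap a c) (swap p q) := by
    intro z
    by_cases zp : z = p
    · left; rw [Perm.mul_apply, swap_apply_of_ne_of_ne, swap_apply_of_ne_of_ne] <;> grind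
    by_cases zq : z = q
    · left; rw [Perm.mul_apply, swap_apply_of_ne_of_ne, swap_apply_of_ne_of_ne] <;> grind
    right; exact swap_apply_of_ne_of_ne zp zq
  have h3 : (swap a b * swap a c) ^ 3 = 1 := by rw [← ht.orderOf, pow_orderOf_eq_one]
  rw [hg, hd.commute.mul_pow, h3, one_mul, pow_succ, pow_two, swap_mul_self, one_mul,
    Perm.card_support_swap hpq]

theorem TwoTrans.eq_top_of_swaps {G : Subgroup (Perm α)} (h2 : TwoTrans G)
    (hα : 12 ≤ Fintype.card α) {a b c d p q : α} (hab : a ≠ b) (hcd : c ≠ d) (hpq : p ≠ q)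
    (h12 : s(a, b) ≠ s(c, d)) (h13 : s(a, b) ≠ s(p, q)) (h23 : s(c, d) ≠ s(p, q))
    (hG : swap a b * swap c d * swap p q ∈ G) : G = ⊤ := by
  classical
  set g := swap a b * swap c d * swap p q with hg
  have hprim := h2.isPreprimitive
  have of3 : (∃ c ∈ G, c.IsThreeCycle) → G = ⊤ := by
    rintro ⟨t, ht, ht'⟩
    have hA := Equiv.Perm.alternatingGroup_le_of_isPreprimitive_of_isThreeCycle_mem hprim ht' ht
    have hsign : Perm.sign g = -1 := by
      rw [hg, Perm.sign_mul, Perm.sign_mul, Perm.sign_swap hab, Perm.sign_swap hcd,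
        Perm.sign_swap hpq]; rfl
    rw [eq_top_iff]
    intro σ _
    rcases Int.units_eq_one_or (Perm.sign σ) with h | h
    · exact hA (Perm.mem_alternatingGroup.mpr h)
    · have : σ * g ∈ alternatingGroup α := by
        rw [Perm.mem_alternatingGroup, Perm.sign_mul, h, hsign]; rfl
      exact (G.mul_mem_cancel_right hG).mp (hA this)
  have of2 : ∀ k ∈ G, k.support.card = 2 → G = ⊤ := fun k hk hk2 =>
    Equiv.Perm.subgroup_eq_top_of_isPreprimitive_of_isSwap_mem hprim k
      (Perm.card_support_eq_two.mp hk2) hk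
  have fin : (g.support.card = 2 ∨ (g ^ 3).support.card = 2 ∨ g.support.card = 4) → G = ⊤ := by
    rintro (h | h | h)
    · exact of2 g hG h
    · exact of2 _ (G.pow_mem hG 3) h
    · exact of3 (exists_isThreeCycle_of_card_support h2 hG (by omega) (by rw [h]; omega))
  have conj : ∀ k s : Perm α, g = s * k * s⁻¹ →
      (k.support.card = 2 ∨ (k ^ 3).support.card = 2 ∨ k.support.card = 4) → G = ⊤ := by
    intro k s hk h
    apply fin
    rw [hk, conj_pow, Perm.card_support_conj, Perm.card_support_conj]
    exact h
  have shared : ∀ a b c d p q : α, a ≠ b → c ≠ d → p ≠ q → s(a, b) ≠ s(c, d) →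
      ¬ (a ≠ c ∧ a ≠ d ∧ b ≠ c ∧ b ≠ d) → ∀ k, k = swap a b * swap c d * swap p q →
      (k.support.card = 2 ∨ (k ^ 3).support.card = 2 ∨ k.support.card = 4) := by
    intro a b c d p q hab hcd hpq h12 hs k hk
    simp only [ne_eq, Sym2.eq_iff] at h12
    by_cases e1 : a = c
    · subst e1
      exact card_support_swap_mul_swap_mul_swap hab hcd (by tauto) hpq hk
    by_cases e2 : a = d
    · subst e2
      rw [swap_comm c a] at hk
      exact card_support_swap_mul_swap_mul_swap hab hcd.symm (by tauto) hpq hk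
    by_cases e3 : b = c
    · subst e3
      rw [swap_comm a b] at hk
      exact card_support_swap_mul_swap_mul_swap hab.symm hcd e2 hpq hk
    by_cases e4 : b = d
    · subst e4
      rw [swap_comm a b, swap_comm c b] at hk
      exact card_support_swap_mul_swap_mul_swap hab.symm hcd.symm e1 hpq hk
    tauto
  by_cases d1 : a ≠ c ∧ a ≠ d ∧ b ≠ c ∧ b ≠ d
  swap
  · exact fin (shared a b c d p q hab hcd hpq h12 d1 g hg)
  by_cases d2 : c ≠ p ∧ c ≠ q ∧ d ≠ p ∧ d ≠ q
  swap
  · exact conj _ (swap a b) (by rw [hg, swap_inv]; simp only [mul_assoc, swap_mul_self, mul_one])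
      (shared c d p q a b hcd hpq hab h23 d2 _ rfl)
  by_cases d3 : p ≠ a ∧ p ≠ b ∧ q ≠ a ∧ q ≠ b
  swap
  · exact conj _ (swap p q) (by
      rw [hg, swap_inv]; simp only [← mul_assoc, swap_mul_self, one_mul])
      (shared p q a b c d hpq hab hcd h13.symm d3 _ rfl)
  have disj : ∀ {a b c d : α}, (a ≠ c ∧ a ≠ d ∧ b ≠ c ∧ b ≠ d) →
      Perm.Disjoint (swap a b) (swap c d) := by
    intro a b c d h z
    by_cases z1 : z = a
    · right; rw [z1]; exact swap_apply_of_ne_of_ne h.1 h.2.1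
    by_cases z2 : z = b
    · right; rw [z2]; exact swap_apply_of_ne_of_ne h.2.2.1 h.2.2.2
    left; exact swap_apply_of_ne_of_ne z1 z2
  have e1 := disj d1
  have e2 := disj d2
  have e3 := (disj d3).symm
  have e4 : Perm.Disjoint (swap a b * swap c d) (swap p q) := e3.mul_left e2
  refine of3 (exists_isThreeCycle_of_involution h2 hα hG (fun z => ?_) ?_)
  · have : g * g = 1 := by
      rw [← pow_two, hg, e4.commute.mul_pow, e1.commute.mul_pow]
      simp only [pow_two, swap_mul_self, mul_one]
    rw [← Perm.mul_apply, this, Perm.one_apply]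
  · rw [hg, e4.card_support_mul, e1.card_support_mul, Perm.card_support_swap hab,
      Perm.card_support_swap hcd, Perm.card_support_swap hpq]
end

section
omit [Fintype Ω]

theorem HGSupersimple.eq_of_mem {B : Finset (Finset Ω)} (hss : HGSupersimple B) {L M : Finset Ω}
    (hL : L ∈ B) (hM : M ∈ B) {p q r : Ω} (hpq : p ≠ q) (hpr : p ≠ r) (hqr : q ≠ r)
    (hp : p ∈ L ∧ p ∈ M) (hq : q ∈ L ∧ q ∈ M) (hr : r ∈ L ∧ r ∈ M) : L = M := by
  by_contra h
  have h1 := hss L hL M hM h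
  have h2 : ({p, q, r} : Finset Ω) ⊆ L ∩ M := by
    intro z hz
    simp only [Finset.mem_insert, Finset.mem_singleton] at hz
    rcases hz with rfl | rfl | rfl <;> simp [hp, hq, hr]
  have h3 := Finset.card_le_card h2
  rw [Finset.card_eq_three.mpr ⟨p, q, r, hpq, hpr, hqr, rfl⟩] at h3
  omega

theorem exists_eq_insert_of_card_four {L : Finset Ω} (h4 : L.card = 4) {x y : Ω} (hxy : x ≠ y)
    (hx : x ∈ L) (hy : y ∈ L) :
    ∃ a b, L = {x, y, a, b} ∧ x ≠ a ∧ x ≠ b ∧ y ≠ a ∧ y ≠ b ∧ a ≠ b := by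
  have hy' : y ∈ L.erase x := Finset.mem_erase.mpr ⟨hxy.symm, hy⟩
  have : ((L.erase x).erase y).card = 2 := by
    rw [Finset.card_erase_of_mem hy', Finset.card_erase_of_mem hx, h4]
  obtain ⟨a, b, hab, h⟩ := Finset.card_eq_two.mp this
  have ha : a ∈ (L.erase x).erase y := by simp [h]
  have hb : b ∈ (L.erase x).erase y := by simp [h]
  simp only [Finset.mem_erase] at ha hb
  refine ⟨a, b, ?_, ha.2.1.symm, hb.2.1.symm, ha.1.symm, hb.1.symm, hab⟩
  rw [← h, Finset.insert_erase hy', Finset.insert_erase hx]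

/-- The second line through two points of a line. -/
theorem exists_second_line {B : Finset (Finset Ω)} (hdes : IsTwoDesign B 2)
    (hss : HGSupersimple B) {L : Finset Ω} (hL : L ∈ B) {x y : Ω} (hxy : x ≠ y) (hx : x ∈ L)
    (hy : y ∈ L) : ∃ c d, {x, y, c, d} ∈ B ∧ x ≠ c ∧ x ≠ d ∧ y ≠ c ∧ y ≠ d ∧ c ≠ d ∧ c ∉ L ∧ d ∉ L ∧
      ∀ M ∈ B, x ∈ M → y ∈ M → M = L ∨ M = {x, y, c, d} := by
  have h2 := hdes.2 x y hxy
  have hLf : L ∈ B.filter fun b => x ∈ b ∧ y ∈ b := by simp [hL, hx, hy]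
  have h1 : ((B.filter fun b => x ∈ b ∧ y ∈ b).erase L).card = 1 := by
    rw [Finset.card_erase_of_mem hLf, h2]
  obtain ⟨L', hL'⟩ := Finset.card_eq_one.mp h1
  have hm : L' ∈ (B.filter fun b => x ∈ b ∧ y ∈ b).erase L := by simp [hL']
  simp only [Finset.mem_erase, Finset.mem_filter] at hm
  obtain ⟨hne, hB, hx', hy'⟩ := hm
  obtain ⟨c, d, rfl, k1, k2, k3, k4, k5⟩ := exists_eq_insert_of_card_four (hdes.1 _ hB) hxy hx' hy'
  refine ⟨c, d, hB, k1, k2, k3, k4, k5, fun h => ?_, fun h => ?_, fun M hM hxM hyM => ?_⟩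
  · exact hne (hss.eq_of_mem hB hL hxy k1 k3 ⟨hx', hx⟩ ⟨hy', hy⟩ ⟨by simp, h⟩)
  · exact hne (hss.eq_of_mem hB hL hxy k2 k4 ⟨hx', hx⟩ ⟨hy', hy⟩ ⟨by simp, h⟩)
  · by_contra! q
    have : M ∈ (B.filter fun b => x ∈ b ∧ y ∈ b).erase L := by simp [q.1, hM, hxM, hyM]
    rw [hL', Finset.mem_singleton] at this
    exact q.2 this

theorem exists_line {B : Finset (Finset Ω)} (hdes : IsTwoDesign B 2) {x y : Ω} (hxy : x ≠ y) :
    ∃ a b, {x, y, a, b} ∈ B ∧ x ≠ a ∧ x ≠ b ∧ y ≠ a ∧ y ≠ b ∧ a ≠ b := by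
  have h2 := hdes.2 x y hxy
  obtain ⟨L, hL⟩ : (B.filter fun b => x ∈ b ∧ y ∈ b).Nonempty := Finset.card_pos.mp (by omega)
  simp only [Finset.mem_filter] at hL
  obtain ⟨a, b, rfl, h⟩ := exists_eq_insert_of_card_four (hdes.1 _ hL.1) hxy hL.2.1 hL.2.2
  exact ⟨a, b, hL.1, h⟩

theorem isElemMove_swaps {B : Finset (Finset Ω)} {x y a b c d : Ω} (hxy : x ≠ y)
    (h1 : {x, y, a, b} ∈ B) (h2 : {x, y, c, d} ∈ B) (hxa : x ≠ a) (hxb : x ≠ b) (hya : y ≠ a)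
    (hyb : y ≠ b) (hab : a ≠ b) (hxc : x ≠ c) (hxd : x ≠ d) (hyc : y ≠ c) (hyd : y ≠ d)
    (hcd : c ≠ d) (hc : c ∉ ({x, y, a, b} : Finset Ω)) (hd : d ∉ ({x, y, a, b} : Finset Ω))
    (hall : ∀ M ∈ B, x ∈ M → y ∈ M → M = {x, y, a, b} ∨ M = {x, y, c, d}) :
    IsElemMove B x y (swap x y * swap a b * swap c d) := by
  simp only [Finset.mem_insert, Finset.mem_singleton, not_or] at hc hd
  refine Or.inr ⟨hxy, ⟨_, h1, by simp, by simp⟩, ?_, ?_, fun z zx zy => ⟨fun hz => ?_, ?_⟩⟩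
  · rw [Perm.mul_apply, Perm.mul_apply, swap_apply_of_ne_of_ne hxc hxd,
      swap_apply_of_ne_of_ne hxa hxb, swap_apply_left]
  · rw [Perm.mul_apply, Perm.mul_apply, swap_apply_of_ne_of_ne hyc hyd,
      swap_apply_of_ne_of_ne hya hyb, swap_apply_right]
  · have k1 := hz _ h1
    have k2 := hz _ h2
    simp only [Finset.mem_insert, Finset.mem_singleton, true_or, or_true, true_and, not_or] at k1 k2
    rw [Perm.mul_apply, Perm.mul_apply, swap_apply_of_ne_of_ne k2.2.2.1 k2.2.2.2,
      swap_apply_of_ne_of_ne k1.2.2.1 k1.2.2.2, swap_apply_of_ne_of_ne zx zy]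
  · intro M hM hxM hyM hzM w hw wx wy wz
    rcases hall M hM hxM hyM with rfl | rfl
    · simp only [Finset.mem_insert, Finset.mem_singleton, zx, zy, wx, wy, false_or] at hzM hw
      rw [Perm.mul_apply, Perm.mul_apply, swap_apply_of_ne_of_ne (x := z) (by grind) (by grind)]
      have : swap a b z = w := by
        rcases hzM with rfl | rfl <;> rcases hw with rfl | rfl <;> simp at wz ⊢
      rw [this, swap_apply_of_ne_of_ne wx wy]
    · simp only [Finset.mem_insert, Finset.mem_singleton, zx, zy, wx, wy, false_or] at hzM hw
      have : swap c d z = w := by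
        rcases hzM with rfl | rfl <;> rcases hw with rfl | rfl <;> simp at wz ⊢
      rw [Perm.mul_apply, Perm.mul_apply, this,
        swap_apply_of_ne_of_ne (x := w) (a := a) (by grind) (by grind),
        swap_apply_of_ne_of_ne wx wy]

end

section
omit [DecidableEq Ω] [Fintype Ω]

theorem IsElemMove.symm {B : Finset (Finset Ω)} {x y : Ω} {g : Perm Ω} (h : IsElemMove B x y g) :
    IsElemMove B y x g⁻¹ := by
  rcases h with ⟨rfl, rfl⟩ | ⟨hne, ⟨L, hL, hx, hy⟩, gx, gy, hz⟩
  · exact Or.inl ⟨rfl, inv_one⟩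
  refine Or.inr ⟨hne.symm, ⟨L, hL, hy, hx⟩, by rw [Perm.inv_eq_iff_eq, gx],
    by rw [Perm.inv_eq_iff_eq, gy], fun z zy zx => ⟨fun h => ?_, ?_⟩⟩
  · rw [Perm.inv_eq_iff_eq, (hz z zx zy).1 fun M hM q => h M hM ⟨q.2.1, q.1, q.2.2⟩]
  · intro M hM yM xM zM w wM wy wx wz
    rw [Perm.inv_eq_iff_eq, (hz w wx wy).2 M hM xM yM wM z zM zx zy wz.symm]

theorem IsElemMove.apply_left {B : Finset (Finset Ω)} {x y : Ω} {g : Perm Ω}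
    (h : IsElemMove B x y g) : g x = y := by
  rcases h with ⟨rfl, rfl⟩ | ⟨_, _, gx, _⟩
  · rfl
  · exact gx

/-- `g` is a move sequence taking the hole from `x` to `y`. -/
inductive Reach (B : Finset (Finset Ω)) : Ω → Ω → Perm Ω → Prop
  | refl (x : Ω) : Reach B x x 1
  | step {x y z : Ω} {e h : Perm Ω} : IsElemMove B x y e → Reach B y z h → Reach B x z (h * e)

variable {B : Finset (Finset Ω)} {x y z : Ω} {g h : Perm Ω}

theorem IsElemMove.reach (hg : IsElemMove B x y g) : Reach B x y g := by
  simpa using Reach.step hg (Reach.refl y)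

theorem Reach.trans (hg : Reach B x y g) (hh : Reach B y z h) : Reach B x z (h * g) := by
  induction hg with
  | refl x => simpa using hh
  | step e _ ih => rw [← mul_assoc]; exact Reach.step e (ih hh)

theorem Reach.symm (hg : Reach B x y g) : Reach B y x g⁻¹ := by
  induction hg with
  | refl x => simpa using Reach.refl x
  | step e _ ih => rw [mul_inv_rev]; exact ih.trans e.symm.reach

theorem Reach.apply_left (hg : Reach B x y g) : g x = y := by
  induction hg with
  | refl x => rfl
  | step e _ ih => rw [Perm.mul_apply, e.apply_left, ih]

theorem Reach.exists_list (hg : Reach B x y g) :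
    ∃ l : List Ω, l.head? = some x ∧ l.getLast? = some y ∧ IsMoveSeq B l g := by
  induction hg with
  | refl x => exact ⟨[x], rfl, rfl, rfl⟩
  | @step x y z e h he _ ih =>
    obtain ⟨l, h1, h2, h3⟩ := ih
    match l, h1 with
    | b :: t, h1 =>
      simp only [List.head?_cons, Option.some.injEq] at h1
      subst h1
      exact ⟨x :: b :: t, rfl, by rw [List.getLast?_cons_cons]; exact h2, e, h, he, h3, rfl⟩

theorem IsMoveSeq.reach : ∀ {l : List Ω} {x y : Ω} {g : Perm Ω}, l.head? = some x →
    l.getLast? = some y → IsMoveSeq B l g → Reach B x y g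
  | [], _, _, _, h, _, _ => by simp at h
  | [a], x, y, g, h1, h2, h3 => by
    simp only [List.head?_cons, List.getLast?_singleton, Option.some.injEq] at h1 h2
    subst h1 h2
    rw [IsMoveSeq] at h3
    rw [h3]
    exact Reach.refl _
  | a :: b :: l, x, y, g, h1, h2, h3 => by
    simp only [List.head?_cons, Option.some.injEq] at h1
    subst h1
    obtain ⟨e, h, he, hh, rfl⟩ := h3
    rw [List.getLast?_cons_cons] at h2
    exact Reach.step he (IsMoveSeq.reach rfl h2 hh)

theorem mem_holeStab_iff : g ∈ holeStab B x ↔ Reach B x x g :=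
  ⟨fun ⟨_, h1, h2, h3⟩ => IsMoveSeq.reach h1 h2 h3, fun h => h.exists_list⟩

/-- The hole stabiliser as a subgroup. -/
def holeSubgroup (B : Finset (Finset Ω)) (x : Ω) : Subgroup (Perm Ω) where
  carrier := {g | Reach B x x g}
  one_mem' := Reach.refl x
  mul_mem' ha hb := hb.trans ha
  inv_mem' h := h.symm

end

section
omit [Fintype Ω]

theorem holeStab_eq_of_comap_eq_top {B : Finset (Finset Ω)} {x : Ω}
    (h : (holeSubgroup B x).comap (Perm.ofSubtype (p := fun y => y ≠ x)) = ⊤) :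
    holeStab B x = {g | g x = x} := by
  ext g
  rw [mem_holeStab_iff, Set.mem_ofPred_eq]
  refine ⟨fun hg => hg.apply_left, fun hg => ?_⟩
  have h1 : ∀ y, g y ≠ x ↔ y ≠ x := by
    intro y
    conv_lhs => rw [← hg]
    simp
  have h2 : ∀ y, g y ≠ y → y ≠ x := by
    rintro y hy rfl; exact hy hg
  have : g.subtypePerm h1 ∈ (holeSubgroup B x).comap (Perm.ofSubtype (p := fun y => y ≠ x)) := by
    rw [h]; trivial
  rw [Subgroup.mem_comap, Perm.ofSubtype_subtypePerm h1 h2] at this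
  exact this

theorem swap_products_mul {x a b c p₁ q₁ p₂ q₂ p₃ q₃ : Ω} {L : Finset Ω} (hL : L = {x, a, b, c})
    (hxa : x ≠ a) (hxb : x ≠ b) (hxc : x ≠ c) (hab : a ≠ b) (hac : a ≠ c) (hbc : b ≠ c)
    (hp₁ : p₁ ∉ L) (hq₁ : q₁ ∉ L) (hp₂ : p₂ ∉ L) (hq₂ : q₂ ∉ L) (hp₃ : p₃ ∉ L) (hq₃ : q₃ ∉ L) :
    swap b x * swap a c * swap p₃ q₃ * (swap a b * swap x c * swap p₂ q₂ *
      (swap x a * swap b c * swap p₁ q₁)) = swap p₃ q₃ * swap p₂ q₂ * swap p₁ q₁ := by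
  have out : ∀ {p q z : Ω}, p ∉ L → q ∉ L → z ∈ L → swap p q z = z := by
    intro p q z hp hq hz
    exact swap_apply_of_ne_of_ne (fun h => hp (h ▸ hz)) (fun h => hq (h ▸ hz))
  have stay : ∀ {p q z : Ω}, p ∉ L → q ∉ L → z ∉ L → swap p q z ∉ L := by
    intro p q z hp hq hz
    rw [swap_apply_def]
    split_ifs <;> assumption
  have inn : ∀ {p q z : Ω}, p ∈ L → q ∈ L → z ∉ L → swap p q z = z := by
    intro p q z hp hq hz
    exact swap_apply_of_ne_of_ne (fun h => hz (h ▸ hp)) (fun h => hz (h ▸ hq))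
  have mx : x ∈ L := by simp [hL]
  have ma : a ∈ L := by simp [hL]
  have mb : b ∈ L := by simp [hL]
  have mc : c ∈ L := by simp [hL]
  ext z
  simp only [Perm.mul_apply]
  by_cases hz : z ∈ L
  · have hz' := hz
    rw [hL] at hz'
    simp only [Finset.mem_insert, Finset.mem_singleton] at hz'
    rw [out hp₁ hq₁ hz, out hp₂ hq₂ hz, out hp₃ hq₃ hz]
    rcases hz' with rfl | rfl | rfl | rfl
    · rw [swap_apply_of_ne_of_ne hxb hxc, swap_apply_left, out hp₂ hq₂ ma,
        swap_apply_of_ne_of_ne hxa.symm hac, swap_apply_left, out hp₃ hq₃ mb,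
        swap_apply_of_ne_of_ne hab.symm hbc, swap_apply_left]
    · rw [swap_apply_of_ne_of_ne hab hac, swap_apply_right, out hp₂ hq₂ mx,
        swap_apply_left, swap_apply_of_ne_of_ne hac.symm hbc.symm, out hp₃ hq₃ mc,
        swap_apply_right, swap_apply_of_ne_of_ne hab hxa.symm]
    · rw [swap_apply_left, swap_apply_of_ne_of_ne hxc.symm hac.symm, out hp₂ hq₂ mc,
        swap_apply_right, swap_apply_of_ne_of_ne hxa hxb, out hp₃ hq₃ mx,
        swap_apply_of_ne_of_ne hxa hxc, swap_apply_right]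
    · rw [swap_apply_right, swap_apply_of_ne_of_ne hxb.symm hab.symm, out hp₂ hq₂ mb,
        swap_apply_of_ne_of_ne hxb.symm hbc, swap_apply_right, out hp₃ hq₃ ma,
        swap_apply_left, swap_apply_of_ne_of_ne hbc.symm hxc.symm]
  · have h1 := stay hp₁ hq₁ hz
    have h2 := stay hp₂ hq₂ h1
    have h3 := stay hp₃ hq₃ h2
    rw [inn mb mc h1, inn mx ma h1, inn mx mc h2, inn ma mb h2, inn ma mc h3, inn mb mx h3]

theorem insert_perm₁ (x a b c : Ω) : ({x, a, b, c} : Finset Ω) = {a, b, x, c} := by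
  ext; simp; tauto

theorem insert_perm₂ (x a b c : Ω) : ({x, a, b, c} : Finset Ω) = {b, x, a, c} := by
  ext; simp; tauto

theorem ne_of_card_insert_eq_four {x y p q : Ω} (h : ({x, y, p, q} : Finset Ω).card = 4) :
    p ≠ x ∧ p ≠ y ∧ q ≠ x ∧ q ≠ y ∧ p ≠ q := by
  have h1 := Finset.card_insert_le x {y, p, q}
  have h2 := Finset.card_insert_le y {p, q}
  have h3 := Finset.card_le_two (a := p) (b := q)
  refine ⟨?_, ?_, ?_, ?_, ?_⟩ <;> rintro rfl
  · rw [Finset.insert_eq_of_mem (by simp)] at h; omega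
  · rw [Finset.insert_eq_of_mem (a := p) (s := {p, q}) (by simp)] at h h1; omega
  · rw [Finset.insert_eq_of_mem (by simp)] at h; omega
  · rw [Finset.insert_eq_of_mem (a := q) (s := {p, q}) (by simp)] at h h1; omega
  · rw [Finset.pair_eq_singleton] at h h1 h2; rw [Finset.card_singleton] at h2; omega

/-- Moving the hole around three points `x, a, b` of a line interchanges the remaining points on
the second lines through these pairs. -/
theorem reach_triangle {B : Finset (Finset Ω)} (hdes : IsTwoDesign B 2) (hss : HGSupersimple B)
    {x a b c p₁ q₁ p₂ q₂ p₃ q₃ : Ω} (hL : {x, a, b, c} ∈ B) (hxa : x ≠ a) (hxb : x ≠ b)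
    (hxc : x ≠ c)
    (hab : a ≠ b) (hac : a ≠ c) (hbc : b ≠ c)
    (h1 : {x, a, p₁, q₁} ∈ B) (h1' : ({x, a, p₁, q₁} : Finset Ω) ≠ {x, a, b, c})
    (h2 : {a, b, p₂, q₂} ∈ B) (h2' : ({a, b, p₂, q₂} : Finset Ω) ≠ {x, a, b, c})
    (h3 : {b, x, p₃, q₃} ∈ B) (h3' : ({b, x, p₃, q₃} : Finset Ω) ≠ {x, a, b, c}) :
    Reach B x x (swap p₃ q₃ * swap p₂ q₂ * swap p₁ q₁) := by
  have main : ∀ {x y u v p q : Ω}, x ≠ y → u ≠ v → x ≠ u → x ≠ v → y ≠ u → y ≠ v →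
      {x, y, u, v} ∈ B → {x, y, p, q} ∈ B → ({x, y, p, q} : Finset Ω) ≠ {x, y, u, v} →
      Reach B x y (swap x y * swap u v * swap p q) ∧ p ∉ ({x, y, u, v} : Finset Ω) ∧
        q ∉ ({x, y, u, v} : Finset Ω) := by
    intro x y u v p q hxy huv k1 k2 k3 k4 hL hM hne
    obtain ⟨r, s, hN, i1, i2, i3, i4, i5, i6, i7, i8⟩ := exists_second_line hdes hss hL hxy
      (by simp) (by simp)
    have e := (i8 _ hM (by simp) (by simp)).resolve_left hne
    obtain ⟨j1, j2, j3, j4, p3⟩ := ne_of_card_insert_eq_four (hdes.1 _ hM)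
    have p1 : p ∈ ({x, y, r, s} : Finset Ω) := by rw [← e]; simp
    have p2 : q ∈ ({x, y, r, s} : Finset Ω) := by rw [← e]; simp
    simp only [Finset.mem_insert, Finset.mem_singleton, j1, j2, j3, j4, false_or] at p1 p2
    have hrs := (isElemMove_swaps hxy hL hN k1 k2 k3 k4 huv i1 i2 i3 i4 i5 i6 i7 i8).reach
    rcases p1 with rfl | rfl <;> rcases p2 with rfl | rfl
    · exact absurd rfl p3
    · exact ⟨hrs, i6, i7⟩
    · exact ⟨by rw [swap_comm p q]; exact hrs, i7, i6⟩
    · exact absurd rfl p3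
  have L2 := insert_perm₁ x a b c
  have L3 := insert_perm₂ x a b c
  obtain ⟨r1, n1, n1'⟩ := main hxa hbc hxb hxc hab hac hL h1 h1'
  obtain ⟨r2, n2, n2'⟩ := main hab hxc hxa.symm hac hxb.symm hbc (L2 ▸ hL) h2 (L2 ▸ h2')
  obtain ⟨r3, n3, n3'⟩ := main hxb.symm hac hab.symm hbc hxa hxc (L3 ▸ hL) h3 (L3 ▸ h3')
  rw [← L2] at n2 n2'
  rw [← L3] at n3 n3'
  have := (r1.trans r2).trans r3
  rw [swap_products_mul rfl hxa hxb hxc hab hac hbc n1 n1' n2 n2' n3 n3'] at this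
  exact this
end

theorem IsTwoDesign.card_mod_three {B : Finset (Finset Ω)} (hdes : IsTwoDesign B 2) (x : Ω) :
    Fintype.card Ω % 3 = 1 := by
  have h := Finset.sum_card_bipartiteAbove_eq_sum_card_bipartiteBelow
    (s := Finset.univ.erase x) (t := B.filter fun b => x ∈ b) (fun y b => y ∈ b)
  have h1 : ∀ y ∈ Finset.univ.erase x, (Finset.bipartiteAbove (fun y b => y ∈ b)
      (B.filter fun b => x ∈ b) y).card = 2 := by
    intro y hy
    rw [← hdes.2 x y (Finset.ne_of_mem_erase hy).symm, Finset.bipartiteAbove, Finset.filter_filter]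
  have h2 : ∀ b ∈ B.filter fun b => x ∈ b, (Finset.bipartiteBelow (fun y b => y ∈ b)
      (Finset.univ.erase x) b).card = 3 := by
    intro b hb
    simp only [Finset.mem_filter] at hb
    have : Finset.bipartiteBelow (fun y b => y ∈ b) (Finset.univ.erase x) b = b.erase x := by
      ext z; simp [Finset.bipartiteBelow]
    rw [this, Finset.card_erase_of_mem hb.2, hdes.1 b hb.1]
  rw [Finset.sum_const_nat h1, Finset.sum_const_nat h2, Finset.card_erase_of_mem (by simp),
    Finset.card_univ] at h
  have : 0 < Fintype.card Ω := Fintype.card_pos_iff.mpr ⟨x⟩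
  omega

omit [Fintype Ω] in
theorem exists_reach_three_swaps {B : Finset (Finset Ω)} (hdes : IsTwoDesign B 2)
    (hss : HGSupersimple B) {x y : Ω} (hxy : x ≠ y) : ∃ a b c d p q : Ω,
      (a ≠ x ∧ b ≠ x ∧ c ≠ x ∧ d ≠ x ∧ p ≠ x ∧ q ≠ x) ∧ a ≠ b ∧ c ≠ d ∧ p ≠ q ∧
      s(a, b) ≠ s(c, d) ∧ s(a, b) ≠ s(p, q) ∧ s(c, d) ≠ s(p, q) ∧
      Reach B x x (swap a b * swap c d * swap p q) := by
  obtain ⟨b, c, hL, hxb, hxc, hyb, hyc, hbc⟩ := exists_line hdes hxy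
  obtain ⟨p₁, q₁, h1, a1, a2, a3, a4, a5, a6, a7, -⟩ := exists_second_line hdes hss hL hxy
    (by simp) (by simp)
  obtain ⟨p₂, q₂, h2, b1, b2, b3, b4, b5, b6, b7, -⟩ := exists_second_line hdes hss hL hyb
    (by simp) (by simp)
  obtain ⟨p₃, q₃, h3, c1, c2, c3, c4, c5, c6, c7, -⟩ := exists_second_line hdes hss hL hxb.symm
    (by simp) (by simp)
  have n1 : ({x, y, p₁, q₁} : Finset Ω) ≠ {x, y, b, c} := fun h => a6 (h ▸ by simp)
  have n2 : ({y, b, p₂, q₂} : Finset Ω) ≠ {x, y, b, c} := fun h => b6 (h ▸ by simp)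
  have n3 : ({b, x, p₃, q₃} : Finset Ω) ≠ {x, y, b, c} := fun h => c6 (h ▸ by simp)
  have hr := reach_triangle hdes hss hL hxy hxb hxc hyb hyc hbc h1 n1 h2 n2 h3 n3
  simp only [Finset.mem_insert, Finset.mem_singleton, not_or] at a6 a7 b6 b7 c6 c7
  have diff : ∀ {u v w p q r s : Ω}, {u, v, p, q} ∈ B → {v, w, r, s} ∈ B → p ≠ q → v ≠ p → v ≠ q →
      u ≠ v → u ≠ w → u ≠ p → u ≠ q → s(p, q) ≠ s(r, s) := by
    intro u v w p q r s hM hN k1 k2 k3 k4 k5 k6 k7 h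
    have hm : ∀ z, z ∈ ({v, w, r, s} : Finset Ω) ↔ z = v ∨ z = w ∨ z ∈ s(p, q) := by
      intro z; rw [h]; simp
    have e := hss.eq_of_mem hM hN k1 k2.symm k3.symm ⟨by simp, by rw [hm]; simp⟩
      ⟨by simp, by rw [hm]; simp⟩ ⟨by simp, by simp⟩
    have : u ∈ ({v, w, r, s} : Finset Ω) := by rw [← e]; simp
    rw [hm] at this
    simp [k4, k5, k6, k7] at this
  refine ⟨p₃, q₃, p₂, q₂, p₁, q₁, ⟨c6.1, c7.1, b6.1, b7.1, a6.1, a7.1⟩, c5, b5, a5, ?_, ?_, ?_, hr⟩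
  · exact (diff h2 h3 b5 b3 b4 hyb hxy.symm b1 b2).symm
  · exact diff h3 h1 c5 c3 c4 hxb.symm hyb.symm c1 c2
  · exact (diff h1 h2 a5 a3 a4 hxy hxb a1 a2).symm

section

omit [Fintype Ω] in
theorem reach_swap_of_line_of_line {B : Finset (Finset Ω)} (hdes : IsTwoDesign B 2)
    (hss : HGSupersimple B) {x e h k a b d : Ω}
    (hall : ∀ z, z = x ∨ z = e ∨ z = h ∨ z = k ∨ z = a ∨ z = b ∨ z = d)
    (hL : {x, e, h, k} ∈ B) (hM : {x, k, a, b} ∈ B) (hN : {x, e, a, d} ∈ B)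
    (hxe : x ≠ e) (hxh : x ≠ h) (hxk : x ≠ k) (hxa : x ≠ a) (hxb : x ≠ b) (hxd : x ≠ d)
    (heh : e ≠ h) (hek : e ≠ k) (hea : e ≠ a) (heb : e ≠ b) (hed : e ≠ d)
    (hhk : h ≠ k) (hha : h ≠ a) (hhb : h ≠ b) (hhd : h ≠ d)
    (hka : k ≠ a) (hkb : k ≠ b) (hkd : k ≠ d) (hab : a ≠ b) (had : a ≠ d) (hbd : b ≠ d) :
    Reach B x x (swap e h) := by
  have hxhbd : {b, x, h, d} ∈ B := by
    obtain ⟨p, q, hP, k1, k2, k3, k4, k5, k6, k7, -⟩ := exists_second_line hdes hss hL hxh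
      (by simp) (by simp)
    simp only [Finset.mem_insert, Finset.mem_singleton, not_or] at k6 k7
    have hp := hall p
    have hq := hall q
    simp only [k6, k7, false_or] at hp hq
    have not_ab : {x, h, a, b} ∉ B := fun hP => by
      have := hss.eq_of_mem hP hM hxa hxb hab (by simp) (by simp) (by simp)
      have : h ∈ ({x, k, a, b} : Finset Ω) := by rw [← this]; simp
      simp [hxh.symm, hhk, hha, hhb] at this
    have not_ad : {x, h, a, d} ∉ B := fun hP => by
      have := hss.eq_of_mem hP hN hxa hxd had (by simp) (by simp) (by simp)
      have : h ∈ ({x, e, a, d} : Finset Ω) := by rw [← this]; simp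
      simp [hxh.symm, heh.symm, hha, hhd] at this
    rw [show ({b, x, h, d} : Finset Ω) = {x, h, b, d} by
      rw [Finset.insert_comm b x, Finset.insert_comm b h]]
    rcases hp with rfl | rfl | rfl <;> rcases hq with rfl | rfl | rfl
    · exact absurd rfl k5
    · exact absurd hP not_ab
    · exact absurd hP not_ad
    · exact absurd (by rwa [Finset.pair_comm]) not_ab
    · exact absurd rfl k5
    · exact hP
    · exact absurd (by rwa [Finset.pair_comm]) not_ad
    · rwa [Finset.pair_comm]
    · exact absurd rfl k5
  have habeh : {a, b, e, h} ∈ B := by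
    obtain ⟨p, q, hP, k1, k2, k3, k4, k5, k6, k7, -⟩ := exists_second_line hdes hss hM hab
      (by simp) (by simp)
    simp only [Finset.mem_insert, Finset.mem_singleton, not_or] at k6 k7
    have hp := hall p
    have hq := hall q
    simp only [k6, k7, false_or] at hp hq
    have not_ed : {a, b, e, d} ∉ B := fun hP => by
      have := hss.eq_of_mem hP hN hea.symm had hed (by simp) (by simp) (by simp)
      have : b ∈ ({x, e, a, d} : Finset Ω) := by rw [← this]; simp
      simp [hxb.symm, heb.symm, hab.symm, hbd] at this
    have not_hd : {a, b, h, d} ∉ B := fun hP => by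
      have := hss.eq_of_mem hP hxhbd hhb.symm hbd hhd (by simp) (by simp) (by simp)
      have : a ∈ ({b, x, h, d} : Finset Ω) := by rw [← this]; simp
      simp [hxa.symm, hha.symm, hab, had] at this
    rcases hp with rfl | rfl | rfl <;> rcases hq with rfl | rfl | rfl
    · exact absurd rfl k5
    · exact hP
    · exact absurd hP not_ed
    · rwa [Finset.pair_comm]
    · exact absurd rfl k5
    · exact absurd hP not_hd
    · exact absurd (by rwa [Finset.pair_comm]) not_ed
    · exact absurd (by rwa [Finset.pair_comm]) not_hd
    · exact absurd rfl k5
  have hM' : {x, a, b, k} ∈ B := by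
    rwa [show ({x, a, b, k} : Finset Ω) = {x, k, a, b} by
      rw [Finset.pair_comm b k, Finset.insert_comm a k]]
  have hN' : {x, a, e, d} ∈ B := by rwa [Finset.insert_comm a e]
  have sep : ∀ {M N : Finset Ω} z, z ∈ M → z ∉ N → M ≠ N := fun z h1 h2 h => h2 (h ▸ h1)
  have hr := reach_triangle hdes hss hM' hxa hxb hxk hab hka.symm hkb.symm hN'
    (sep e (by simp) (by simp [hxe.symm, hea, heb, hek]))
    habeh (sep e (by simp) (by simp [hxe.symm, hea, heb, hek]))
    hxhbd (sep h (by simp) (by simp [hxh.symm, hha, hhb, hhk]))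
  have : swap h d * swap e h * swap e d = swap e h := by
    ext z
    simp only [Perm.mul_apply, swap_apply_def]
    grind
  rwa [this] at hr

theorem reach_swap_of_line {B : Finset (Finset Ω)} (hdes : IsTwoDesign B 2)
    (hss : HGSupersimple B) (h7 : Fintype.card Ω = 7) {x e h k : Ω} (hL : {x, e, h, k} ∈ B)
    (hxe : x ≠ e) (hxh : x ≠ h) (hxk : x ≠ k) (heh : e ≠ h) (hek : e ≠ k) (hhk : h ≠ k) :
    Reach B x x (swap e h) := by
  obtain ⟨a, b, hM, hxa, hxb, hka, hkb, hab, ha, hb, -⟩ := exists_second_line hdes hss hL hxk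
    (by simp) (by simp)
  obtain ⟨p, q, hP, -, -, -, -, k5, k6, k7, -⟩ := exists_second_line hdes hss hL hxe
    (by simp) (by simp)
  simp only [Finset.mem_insert, Finset.mem_singleton, not_or] at ha hb k6 k7
  have h6 : ({x, e, h, k, a, b} : Finset Ω).card = 6 := by
    rw [Finset.card_insert_of_notMem, Finset.card_insert_of_notMem, Finset.card_insert_of_notMem,
      Finset.card_insert_of_notMem, Finset.card_pair hab]
    · simp [hka, hkb]
    · simp [hhk, Ne.symm ha.2.2.1, Ne.symm hb.2.2.1]
    · simp [heh, hek, Ne.symm ha.2.1, Ne.symm hb.2.1]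
    · simp [hxe, hxh, hxk, hxa, hxb]
  have h1 : ({x, e, h, k, a, b} : Finset Ω)ᶜ.card = 1 := by rw [Finset.card_compl, h6, h7]
  obtain ⟨d, hd⟩ := Finset.card_eq_one.mp h1
  have hall : ∀ z, z = x ∨ z = e ∨ z = h ∨ z = k ∨ z = a ∨ z = b ∨ z = d := by
    intro z
    have : z ∈ ({x, e, h, k, a, b} : Finset Ω) ∨ z ∈ ({x, e, h, k, a, b} : Finset Ω)ᶜ := by
      rw [Finset.mem_compl]; exact em _
    rw [hd] at this
    simp only [Finset.mem_insert, Finset.mem_singleton, or_assoc] at this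
    exact this
  have hd' : d ∈ ({x, e, h, k, a, b} : Finset Ω)ᶜ := by rw [hd]; simp
  simp only [Finset.mem_compl, Finset.mem_insert, Finset.mem_singleton, not_or] at hd'
  obtain ⟨dx, de, dh, dk, da, db⟩ := hd'
  have not_ab : {x, e, a, b} ∉ B := fun hP => by
    have := hss.eq_of_mem hP hM hxa hxb hab (by simp) (by simp) (by simp)
    have : e ∈ ({x, k, a, b} : Finset Ω) := by rw [← this]; simp
    simp [hxe.symm, hek, Ne.symm ha.2.1, Ne.symm hb.2.1] at this
  have case_a : {x, e, a, d} ∈ B → Reach B x x (swap e h) := fun hN =>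
    reach_swap_of_line_of_line hdes hss hall hL hM hN hxe hxh hxk hxa hxb (Ne.symm dx) heh hek
      (Ne.symm ha.2.1) (Ne.symm hb.2.1) (Ne.symm de) hhk (Ne.symm ha.2.2.1) (Ne.symm hb.2.2.1)
      (Ne.symm dh) hka hkb (Ne.symm dk) hab (Ne.symm da) (Ne.symm db)
  have hall' : ∀ z, z = x ∨ z = e ∨ z = h ∨ z = k ∨ z = b ∨ z = a ∨ z = d := by
    intro z
    rcases hall z with h | h | h | h | h | h | h
    exacts [Or.inl h, Or.inr (Or.inl h), Or.inr (Or.inr (Or.inl h)),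
      Or.inr (Or.inr (Or.inr (Or.inl h))), Or.inr (Or.inr (Or.inr (Or.inr (Or.inr (Or.inl h))))),
      Or.inr (Or.inr (Or.inr (Or.inr (Or.inl h)))),
      Or.inr (Or.inr (Or.inr (Or.inr (Or.inr (Or.inr h)))))]
  have case_b : {x, e, b, d} ∈ B → Reach B x x (swap e h) := fun hN =>
    reach_swap_of_line_of_line hdes hss (a := b) (b := a) hall' hL
      (by rwa [Finset.pair_comm]) hN hxe hxh hxk hxb hxa (Ne.symm dx) heh hek
      (Ne.symm hb.2.1) (Ne.symm ha.2.1) (Ne.symm de) hhk (Ne.symm hb.2.2.1) (Ne.symm ha.2.2.1)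
      (Ne.symm dh) hkb hka (Ne.symm dk) hab.symm (Ne.symm db) (Ne.symm da)
  have hp := hall p
  have hq := hall q
  simp only [k6, k7, false_or] at hp hq
  rcases hp with rfl | rfl | rfl <;> rcases hq with rfl | rfl | rfl
  · exact absurd rfl k5
  · exact absurd hP not_ab
  · exact case_a hP
  · exact absurd (by rwa [Finset.pair_comm]) not_ab
  · exact absurd rfl k5
  · exact case_b hP
  · exact case_a (by rwa [Finset.pair_comm])
  · exact case_b (by rwa [Finset.pair_comm])
  · exact absurd rfl k5

/-- The points on the lines through `x` and `y`. -/
def lineClosure (B : Finset (Finset Ω)) (x y : Ω) : Finset Ω :=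
  Finset.univ.filter fun z => z = x ∨ z = y ∨ ∃ L ∈ B, x ∈ L ∧ y ∈ L ∧ z ∈ L

theorem mem_lineClosure {B : Finset (Finset Ω)} {x y z : Ω} :
    z ∈ lineClosure B x y ↔ z = x ∨ z = y ∨ ∃ L ∈ B, x ∈ L ∧ y ∈ L ∧ z ∈ L := by
  simp [lineClosure]

theorem left_mem_lineClosure (B : Finset (Finset Ω)) (x y : Ω) : x ∈ lineClosure B x y := by
  simp [lineClosure]

theorem right_mem_lineClosure (B : Finset (Finset Ω)) (x y : Ω) : y ∈ lineClosure B x y := by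
  simp [lineClosure]

theorem lineClosure_comm (B : Finset (Finset Ω)) (x y : Ω) :
    lineClosure B x y = lineClosure B y x := by
  ext z
  simp only [mem_lineClosure]
  constructor
  · rintro (h | h | ⟨L, h, hx, hy, hz⟩)
    exacts [Or.inr (Or.inl h), Or.inl h, Or.inr (Or.inr ⟨L, h, hy, hx, hz⟩)]
  · rintro (h | h | ⟨L, h, hx, hy, hz⟩)
    exacts [Or.inr (Or.inl h), Or.inl h, Or.inr (Or.inr ⟨L, h, hy, hx, hz⟩)]

theorem mem_lineClosure_rotate {B : Finset (Finset Ω)} {x y z : Ω}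
    (hxz : z ≠ x) (hyz : z ≠ y) (h : z ∈ lineClosure B x y) : x ∈ lineClosure B y z := by
  rw [mem_lineClosure] at h ⊢
  rcases h with h | h | ⟨L, h, hx, hy, hz⟩
  exacts [absurd h hxz, absurd h hyz, Or.inr (Or.inr ⟨L, h, hy, hz, hx⟩)]

theorem card_lineClosure {B : Finset (Finset Ω)} (hdes : IsTwoDesign B 2) (hss : HGSupersimple B)
    {x y : Ω} (hxy : x ≠ y) : (lineClosure B x y).card = 6 := by
  obtain ⟨a, b, hL, k1, k2, k3, k4, k5⟩ := exists_line hdes hxy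
  obtain ⟨c, d, hM, l1, l2, l3, l4, l5, l6, l7, l8⟩ := exists_second_line hdes hss hL hxy
    (by simp) (by simp)
  have : lineClosure B x y = {x, y, a, b, c, d} := by
    ext z
    rw [mem_lineClosure]
    simp only [Finset.mem_insert, Finset.mem_singleton]
    constructor
    · rintro (h | h | ⟨L, h, hx, hy, hz⟩)
      · simp [h]
      · simp [h]
      · rcases l8 L h hx hy with rfl | rfl <;>
          simp only [Finset.mem_insert, Finset.mem_singleton] at hz <;> tauto
    · rintro (h | h | h | h | h | h)
      · exact Or.inl h
      · exact Or.inr (Or.inl h)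
      · exact Or.inr (Or.inr ⟨_, hL, by simp, by simp, by simp [h]⟩)
      · exact Or.inr (Or.inr ⟨_, hL, by simp, by simp, by simp [h]⟩)
      · exact Or.inr (Or.inr ⟨_, hM, by simp, by simp, by simp [h]⟩)
      · exact Or.inr (Or.inr ⟨_, hM, by simp, by simp, by simp [h]⟩)
  simp only [Finset.mem_insert, Finset.mem_singleton, not_or] at l6 l7
  rw [this, Finset.card_insert_of_notMem, Finset.card_insert_of_notMem,
    Finset.card_insert_of_notMem, Finset.card_insert_of_notMem, Finset.card_pair l5]
  · simp [Ne.symm l6.2.2.2, Ne.symm l7.2.2.2]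
  · simp [k5, Ne.symm l6.2.2.1, Ne.symm l7.2.2.1]
  · simp [k3, k4, l3, l4]
  · simp [hxy, k1, k2, l1, l2]

theorem reach_swap_of_card_seven {B : Finset (Finset Ω)} (hdes : IsTwoDesign B 2)
    (hss : HGSupersimple B) (h7 : Fintype.card Ω = 7) {x a b : Ω} (hxa : x ≠ a) (hxb : x ≠ b)
    (hab : a ≠ b) : Reach B x x (swap a b) := by
  have near : ∀ {a b : Ω}, x ≠ a → x ≠ b → a ≠ b → b ∈ lineClosure B x a →
      Reach B x x (swap a b) := by
    intro a b hxa hxb hab h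
    rw [mem_lineClosure] at h
    obtain ⟨L, hL, hx, ha, hb⟩ := (h.resolve_left hxb.symm).resolve_left hab.symm
    obtain ⟨p, q, rfl, k1, k2, k3, k4, k5⟩ := exists_eq_insert_of_card_four (hdes.1 _ hL) hxa hx ha
    simp only [Finset.mem_insert, Finset.mem_singleton, hxb.symm, hab.symm, false_or] at hb
    rcases hb with rfl | rfl
    · exact reach_swap_of_line hdes hss h7 hL hxa hxb k2 hab k4 k5
    · rw [Finset.pair_comm] at hL
      exact reach_swap_of_line hdes hss h7 hL hxa hxb k1 hab k3 k5.symm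
  by_cases h : b ∈ lineClosure B x a
  · exact near hxa hxb hab h
  have hc : ({b} : Finset Ω) = (lineClosure B x a)ᶜ := by
    apply Finset.eq_of_subset_of_card_le
    · intro z hz; rw [Finset.mem_singleton] at hz; rw [hz]; simpa using h
    · rw [Finset.card_compl, card_lineClosure hdes hss hxa, h7]; simp
  have h' : a ∉ lineClosure B x b := fun h' => h (by
    rw [lineClosure_comm]
    exact mem_lineClosure_rotate hxb hxa (mem_lineClosure_rotate hxa.symm hab h'))
  have hc' : ({a} : Finset Ω) = (lineClosure B x b)ᶜ := by
    apply Finset.eq_of_subset_of_card_le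
    · intro z hz; rw [Finset.mem_singleton] at hz; rw [hz]; simpa using h'
    · rw [Finset.card_compl, card_lineClosure hdes hss hxb, h7]; simp
  obtain ⟨f, hf⟩ : ∃ f, f ∉ ({x, a, b} : Finset Ω) := by
    by_contra! q
    have := Finset.card_le_card (s := Finset.univ) (t := {x, a, b}) fun z _ => q z
    rw [Finset.card_univ, h7] at this
    have := Finset.card_le_three (a := x) (b := a) (c := b)
    omega
  simp only [Finset.mem_insert, Finset.mem_singleton, not_or] at hf
  have f1 : f ∈ lineClosure B x a := by
    by_contra q
    rw [← Finset.mem_compl, ← hc, Finset.mem_singleton] at q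
    exact hf.2.2 q
  have f2 : f ∈ lineClosure B x b := by
    by_contra q
    rw [← Finset.mem_compl, ← hc', Finset.mem_singleton] at q
    exact hf.2.1 q
  have r1 := near hxa (Ne.symm hf.1) (Ne.symm hf.2.1) f1
  have r2 := near hxb (Ne.symm hf.1) (Ne.symm hf.2.2) f2
  have := (r2.trans r1).trans r2
  rwa [← mul_assoc, swap_comm b f, swap_mul_swap_mul_swap (Ne.symm hf.2.1) hab, swap_comm] at this

theorem holeStab_of_card_seven {B : Finset (Finset Ω)} (hdes : IsTwoDesign B 2)
    (hss : HGSupersimple B) (h7 : Fintype.card Ω = 7) (x : Ω) :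
    holeStab B x = {g | g x = x} := by
  apply holeStab_eq_of_comap_eq_top
  rw [eq_top_iff, ← Perm.closure_isSwap, Subgroup.closure_le]
  rintro _ ⟨a, b, hab, rfl⟩
  rw [SetLike.mem_coe, Subgroup.mem_comap, Perm.ofSubtype_swap_eq]
  exact reach_swap_of_card_seven hdes hss h7 a.2.symm b.2.symm (fun h => hab (Subtype.ext h))
end

section

theorem mem_lineClosure_right {B : Finset (Finset Ω)} {x y z : Ω} (hzx : z ≠ x) (hzy : z ≠ y)
    (hxy : x ≠ y) (h : z ∈ lineClosure B x y) : y ∈ lineClosure B x z := by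
  rw [lineClosure_comm]
  exact mem_lineClosure_rotate hxy hzx.symm (mem_lineClosure_rotate hzx hzy h)

theorem mem_lineClosure_of_line {B : Finset (Finset Ω)} {L : Finset Ω} (hL : L ∈ B) {x y z : Ω}
    (hx : x ∈ L) (hy : y ∈ L) (hz : z ∈ L) : z ∈ lineClosure B x y :=
  mem_lineClosure.mpr (Or.inr (Or.inr ⟨L, hL, hx, hy, hz⟩))

/-- The points other than `u` and `v` split into two parts such that any two points in different
parts are on a line with `u` or on a line with `v`. -/
structure IsSplit (B : Finset (Finset Ω)) (u v : Ω) (S T : Finset Ω) : Prop where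
  ne : u ≠ v
  mem_or : ∀ z, z ≠ u → z ≠ v → z ∈ S ∨ z ∈ T
  disj : ∀ z ∈ S, z ∉ T
  left : ∀ z ∈ S, z ≠ u ∧ z ≠ v
  right : ∀ z ∈ T, z ≠ u ∧ z ≠ v
  near : ∀ a ∈ S, ∀ b ∈ T, b ∈ lineClosure B a u ∨ b ∈ lineClosure B a v

variable {B : Finset (Finset Ω)} {u v : Ω} {S T : Finset Ω}

theorem IsSplit.symm (h : IsSplit B u v S T) : IsSplit B u v T S where
  ne := h.ne
  mem_or z hu hv := (h.mem_or z hu hv).symm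
  disj z hz hz' := h.disj z hz' hz
  left := h.right
  right := h.left
  near a ha b hb := by
    have hab : a ≠ b := fun e => h.disj b hb (e ▸ ha)
    rcases h.near b hb a ha with k | k
    · left
      rw [lineClosure_comm]
      exact mem_lineClosure_rotate hab (h.right a ha).1 k
    · right
      rw [lineClosure_comm]
      exact mem_lineClosure_rotate hab (h.right a ha).2 k

theorem IsSplit.card_add_card (h : IsSplit B u v S T) : S.card + T.card + 2 = Fintype.card Ω := by
  rw [← Finset.card_union_of_disjoint (Finset.disjoint_left.mpr h.disj), ← Finset.card_pair h.ne,
    ← Finset.card_univ]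
  have : S ∪ T = Finset.univ \ {u, v} := by
    ext z
    simp only [Finset.mem_union, Finset.mem_sdiff, Finset.mem_univ, true_and, Finset.mem_insert,
      Finset.mem_singleton, not_or]
    exact ⟨fun hz => hz.elim (h.left z) (h.right z), fun hz => h.mem_or z hz.1 hz.2⟩
  rw [this]
  exact Finset.card_sdiff_add_card_eq_card (Finset.subset_univ _)

/-- The points of `S` on a line with `a` and `u`, or on a line with `a` and `v`. -/
def mates (B : Finset (Finset Ω)) (u v : Ω) (S : Finset Ω) (a : Ω) : Finset Ω :=
  S.filter fun b => b ≠ a ∧ (b ∈ lineClosure B a u ∨ b ∈ lineClosure B a v)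

theorem IsSplit.card_add_card_mates (hdes : IsTwoDesign B 2) (hss : HGSupersimple B)
    (h : IsSplit B u v S T) {a : Ω} (ha : a ∈ S) : T.card + (mates B u v S a).card ≤ 8 := by
  obtain ⟨hau, hav⟩ := h.left a ha
  have hd : Disjoint T (mates B u v S a) := by
    rw [Finset.disjoint_left]
    intro z hz hz'
    exact h.disj z (Finset.mem_filter.mp hz').1 hz
  have hsub : T ∪ mates B u v S a ⊆
      (lineClosure B a u \ {a, u}) ∪ (lineClosure B a v \ {a, v}) := by
    intro z hz
    have hz' : z ≠ a ∧ z ≠ u ∧ z ≠ v ∧ (z ∈ lineClosure B a u ∨ z ∈ lineClosure B a v) := by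
      rw [Finset.mem_union] at hz
      rcases hz with hz | hz
      · exact ⟨fun e => h.disj a ha (e ▸ hz), (h.right z hz).1, (h.right z hz).2, h.near a ha z hz⟩
      · obtain ⟨hS, hne, hm⟩ := Finset.mem_filter.mp hz
        exact ⟨hne, (h.left z hS).1, (h.left z hS).2, hm⟩
    simp only [Finset.mem_union, Finset.mem_sdiff, Finset.mem_insert, Finset.mem_singleton, not_or]
    rcases hz'.2.2.2 with k | k
    · exact Or.inl ⟨k, hz'.1, hz'.2.1⟩
    · exact Or.inr ⟨k, hz'.1, hz'.2.2.1⟩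
  have four : ∀ {w : Ω}, a ≠ w → (lineClosure B a w \ {a, w}).card = 4 := by
    intro w haw
    rw [Finset.card_sdiff_of_subset, card_lineClosure hdes hss haw, Finset.card_pair haw]
    intro z hz
    simp only [Finset.mem_insert, Finset.mem_singleton] at hz
    rcases hz with rfl | rfl
    exacts [left_mem_lineClosure _ _ _, right_mem_lineClosure _ _ _]
  have := (Finset.card_le_card hsub).trans (Finset.card_union_le _ _)
  rwa [Finset.card_union_of_disjoint hd, four hau, four hav] at this

theorem exists_line_of_mem_lineClosure (hdes : IsTwoDesign B 2) {a : Ω} (huv : u ≠ v) (hau : a ≠ u)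
    (hav : a ≠ v) (h : a ∈ lineClosure B u v) :
    ∃ w, {u, v, a, w} ∈ B ∧ w ≠ u ∧ w ≠ v ∧ w ≠ a := by
  rw [mem_lineClosure] at h
  obtain ⟨L, hL, hx, hy, hz⟩ := (h.resolve_left hau).resolve_left hav
  obtain ⟨p, q, rfl, k1, k2, k3, k4, k5⟩ := exists_eq_insert_of_card_four (hdes.1 _ hL) huv hx hy
  simp only [Finset.mem_insert, Finset.mem_singleton, hau, hav, false_or] at hz
  rcases hz with rfl | rfl
  · exact ⟨q, hL, k2.symm, k4.symm, k5.symm⟩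
  · exact ⟨p, by rwa [Finset.pair_comm], k1.symm, k3.symm, k5⟩

theorem IsSplit.card_right_le_five (hdes : IsTwoDesign B 2) (hss : HGSupersimple B)
    (h : IsSplit B u v S T) {a : Ω} (ha : a ∈ S) (hm : a ∈ lineClosure B u v) : T.card ≤ 5 := by
  obtain ⟨hau, hav⟩ := h.left a ha
  obtain ⟨w, hL, wu, wv, wa⟩ := exists_line_of_mem_lineClosure hdes h.ne hau hav hm
  have hsub : T ⊆ (lineClosure B a u \ {a, u, v}) ∪ (lineClosure B a v \ {a, u, v}) := by
    intro z hz
    have h1 : z ≠ a := fun e => h.disj a ha (e ▸ hz)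
    have h2 := h.right z hz
    simp only [Finset.mem_union, Finset.mem_sdiff, Finset.mem_insert, Finset.mem_singleton, not_or]
    rcases h.near a ha z hz with k | k
    · exact Or.inl ⟨k, h1, h2⟩
    · exact Or.inr ⟨k, h1, h2⟩
  have three : ∀ {w : Ω}, a ≠ w → w ∈ ({u, v, a, w} : Finset Ω) →
      ({a, u, v} : Finset Ω) ⊆ lineClosure B a w → (lineClosure B a w \ {a, u, v}).card = 3 := by
    intro w haw _ hs
    rw [Finset.card_sdiff_of_subset hs, card_lineClosure hdes hss haw,
      Finset.card_eq_three.mpr ⟨a, u, v, hau, hav, h.ne, rfl⟩]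
  have sub : ∀ {t : Ω}, t ∈ ({u, v, a, w} : Finset Ω) →
      ({a, u, v} : Finset Ω) ⊆ lineClosure B a t := by
    intro t ht z hz
    exact mem_lineClosure_of_line hL (by simp) ht (by
      simp only [Finset.mem_insert, Finset.mem_singleton] at hz ⊢; tauto)
  have hw : w ∈ (lineClosure B a u \ {a, u, v}) ∩ (lineClosure B a v \ {a, u, v}) := by
    simp only [Finset.mem_inter, Finset.mem_sdiff, Finset.mem_insert, Finset.mem_singleton, wa, wu,
      wv, or_self, not_false_eq_true, and_true]
    exact ⟨mem_lineClosure_of_line hL (by simp) (by simp) (by simp),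
      mem_lineClosure_of_line hL (by simp) (by simp) (by simp)⟩
  have h1 := Finset.card_pos.mpr ⟨w, hw⟩
  have h2 := Finset.card_union_add_card_inter (lineClosure B a u \ {a, u, v})
    (lineClosure B a v \ {a, u, v})
  have h3 := Finset.card_le_card hsub
  rw [three hau (by simp) (sub (by simp)), three hav (by simp) (sub (by simp))] at h2
  omega

/-- Points of the part not meeting the lines through `u` and `v` which are on a line with `u` and
a point `p` of such a line are confined to the second line through `u` and `p`. -/
theorem exists_pair_of_disjoint (hdes : IsTwoDesign B 2) (hss : HGSupersimple B) (huv : u ≠ v)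
    {p : Ω} (hpu : p ≠ u) (hpv : p ≠ v) (hp : p ∈ lineClosure B u v)
    (hS : ∀ z ∈ S, z ∉ lineClosure B u v) :
    ∃ s t, {u, p, s, t} ∈ B ∧ s ≠ t ∧ s ≠ p ∧ t ≠ p ∧ ∀ z ∈ S, z ∈ lineClosure B p u →
      z = s ∨ z = t := by
  obtain ⟨w, hL, -⟩ := exists_line_of_mem_lineClosure hdes huv hpu hpv hp
  obtain ⟨s, t, hM, k1, k2, k3, k4, k5, -, -, k8⟩ := exists_second_line hdes hss hL hpu.symm
    (by simp) (by simp)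
  have out : ∀ z ∈ ({u, v, p, w} : Finset Ω), z ∈ lineClosure B u v := fun z hz =>
    mem_lineClosure_of_line hL (by simp) (by simp) hz
  refine ⟨s, t, hM, k5, k3.symm, k4.symm, fun z hz hm => ?_⟩
  rw [mem_lineClosure] at hm
  rcases hm with rfl | rfl | ⟨N, hN, hpN, huN, hzN⟩
  · exact absurd hp (hS z hz)
  · exact absurd (left_mem_lineClosure B z v) (hS z hz)
  · rcases k8 N hN huN hpN with rfl | rfl
    · exact absurd (out z hzN) (hS z hz)
    · simp only [Finset.mem_insert, Finset.mem_singleton] at hzN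
      rcases hzN with rfl | rfl | h
      · exact absurd (left_mem_lineClosure B z v) (hS z hz)
      · exact absurd hp (hS z hz)
      · exact h

theorem IsSplit.false_of_disjoint (hdes : IsTwoDesign B 2) (hss : HGSupersimple B)
    (hn : 13 ≤ Fintype.card Ω) (h : IsSplit B u v S T) (hSn : S.Nonempty)
    (hS : ∀ z ∈ S, z ∉ lineClosure B u v) : False := by
  have hcard := h.card_add_card
  have key : ∀ x ∈ S, ∀ p, p ≠ u → p ≠ v → p ∈ lineClosure B u v → S.card ≤ 4 ∧
      ∃ y ∈ mates B u v S x,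
      p ∈ lineClosure B x y ∧ (u ∈ lineClosure B x y ∨ v ∈ lineClosure B x y) := by
    intro x hx p hpu hpv hp
    have hpT : p ∈ T := (h.mem_or p hpu hpv).resolve_left fun k => hS p k hp
    obtain ⟨s, t, hM, hst, hsp, htp, hs⟩ := exists_pair_of_disjoint hdes hss h.ne hpu hpv hp hS
    obtain ⟨s', t', hM', hst', hsp', htp', hs'⟩ := exists_pair_of_disjoint hdes hss h.ne.symm hpv
        hpu
      (lineClosure_comm B u v ▸ hp) (fun z hz => lineClosure_comm B u v ▸ hS z hz)
    have hsub : S ⊆ {s, t, s', t'} := by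
      intro z hz
      simp only [Finset.mem_insert, Finset.mem_singleton]
      rcases h.symm.near p hpT z hz with k | k
      · rcases hs z hz k with k | k <;> simp [k]
      · rcases hs' z hz k with k | k <;> simp [k]
    have mate : ∀ {w s t : Ω}, w = u ∨ w = v → {w, p, s, t} ∈ B → s ≠ t → s ∈ S → t ∈ S →
        t ∈ mates B u v S s ∧ p ∈ lineClosure B s t ∧
          (u ∈ lineClosure B s t ∨ v ∈ lineClosure B s t) := by
      intro w s t hw hN hne hs ht
      have m := @mem_lineClosure_of_line _ _ _ B _ hN
      refine ⟨Finset.mem_filter.mpr ⟨ht, hne.symm, ?_⟩, m (by simp) (by simp) (by simp), ?_⟩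
      · rcases hw with rfl | rfl
        · exact Or.inl (m (by simp) (by simp) (by simp))
        · exact Or.inr (m (by simp) (by simp) (by simp))
      · rcases hw with rfl | rfl
        · exact Or.inl (m (by simp) (by simp) (by simp))
        · exact Or.inr (m (by simp) (by simp) (by simp))
    have hSc : 3 ≤ S.card := by
      have := h.card_add_card_mates hdes hss hx
      omega
    refine ⟨(Finset.card_le_card hsub).trans Finset.card_le_four, ?_⟩
    have mate_exists : ∃ a ∈ S, (mates B u v S a).Nonempty := by
      by_cases k1 : s ∈ S ∧ t ∈ S
      · exact ⟨s, k1.1, t, (mate (Or.inl rfl) hM hst k1.1 k1.2).1⟩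
      by_cases k2 : s' ∈ S ∧ t' ∈ S
      · exact ⟨s', k2.1, t', (mate (Or.inr rfl) hM' hst' k2.1 k2.2).1⟩
      exfalso
      obtain ⟨e, he⟩ : ∃ e, S ∩ {s, t} ⊆ {e} := by
        rcases not_and_or.mp k1 with k | k
        · refine ⟨t, fun z hz => ?_⟩
          simp only [Finset.mem_inter, Finset.mem_insert, Finset.mem_singleton] at hz ⊢
          exact hz.2.resolve_left fun e => k (e ▸ hz.1)
        · refine ⟨s, fun z hz => ?_⟩
          simp only [Finset.mem_inter, Finset.mem_insert, Finset.mem_singleton] at hz ⊢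
          exact hz.2.resolve_right fun e => k (e ▸ hz.1)
      obtain ⟨e', he'⟩ : ∃ e, S ∩ {s', t'} ⊆ {e} := by
        rcases not_and_or.mp k2 with k | k
        · refine ⟨t', fun z hz => ?_⟩
          simp only [Finset.mem_inter, Finset.mem_insert, Finset.mem_singleton] at hz ⊢
          exact hz.2.resolve_left fun e => k (e ▸ hz.1)
        · refine ⟨s', fun z hz => ?_⟩
          simp only [Finset.mem_inter, Finset.mem_insert, Finset.mem_singleton] at hz ⊢
          exact hz.2.resolve_right fun e => k (e ▸ hz.1)
      have hsub' : S ⊆ {e, e'} := by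
        intro z hz
        have hz' := hsub hz
        simp only [Finset.mem_insert, Finset.mem_singleton] at hz' ⊢
        have i1 : z = s ∨ z = t → z = e := fun k =>
          Finset.mem_singleton.mp (he (by simp [hz, k]))
        have i2 : z = s' ∨ z = t' → z = e' := fun k =>
          Finset.mem_singleton.mp (he' (by simp [hz, k]))
        tauto
      have := (Finset.card_le_card hsub').trans Finset.card_le_two
      omega
    obtain ⟨a, ha, hne⟩ := mate_exists
    have h1 := h.card_add_card_mates hdes hss ha
    have h2 := Finset.card_pos.mpr hne
    have hSe : S = {s, t, s', t'} := by
      apply Finset.eq_of_subset_of_card_le hsub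
      have := Finset.card_le_four (a := s) (b := t) (c := s') (d := t')
      omega
    have ms : s ∈ S := by rw [hSe]; simp
    have mt : t ∈ S := by rw [hSe]; simp
    have ms' : s' ∈ S := by rw [hSe]; simp
    have mt' : t' ∈ S := by rw [hSe]; simp
    have hx' := hsub hx
    simp only [Finset.mem_insert, Finset.mem_singleton] at hx'
    rcases hx' with rfl | rfl | rfl | rfl
    · exact ⟨t, mate (Or.inl rfl) hM hst hx mt⟩
    · exact ⟨s, mate (Or.inl rfl) (by rwa [Finset.pair_comm]) hst.symm hx ms⟩
    · exact ⟨t', mate (Or.inr rfl) hM' hst' hx mt'⟩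
    · exact ⟨s', mate (Or.inr rfl) (by rwa [Finset.pair_comm]) hst'.symm hx ms'⟩
  obtain ⟨x, hx⟩ := hSn
  have hP : (lineClosure B u v \ {u, v}).card = 4 := by
    rw [Finset.card_sdiff_of_subset, card_lineClosure hdes hss h.ne, Finset.card_pair h.ne]
    intro z hz
    simp only [Finset.mem_insert, Finset.mem_singleton] at hz
    rcases hz with rfl | rfl
    exacts [left_mem_lineClosure _ _ _, right_mem_lineClosure _ _ _]
  have hPm : ∀ {p}, p ∈ lineClosure B u v \ {u, v} → p ≠ u ∧ p ≠ v ∧ p ∈ lineClosure B u v := by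
    intro p hp
    simp only [Finset.mem_sdiff, Finset.mem_insert, Finset.mem_singleton, not_or] at hp
    exact ⟨hp.2.1, hp.2.2, hp.1⟩
  obtain ⟨p, hp⟩ : (lineClosure B u v \ {u, v}).Nonempty := Finset.card_pos.mp (by omega)
  obtain ⟨hS4, y, hy, -, hw⟩ := key x hx p (hPm hp).1 (hPm hp).2.1 (hPm hp).2.2
  have h1 : (mates B u v S x).card ≤ 1 := by
    have := h.card_add_card_mates hdes hss hx
    omega
  have hyx := (Finset.mem_filter.mp hy).2.1
  have hyS := (Finset.mem_filter.mp hy).1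
  have hsub : lineClosure B u v \ {u, v} ⊆ lineClosure B x y := by
    intro q hq
    obtain ⟨-, y', hy', hq', -⟩ := key x hx q (hPm hq).1 (hPm hq).2.1 (hPm hq).2.2
    rwa [Finset.card_le_one.mp h1 y' hy' y hy] at hq'
  obtain ⟨w, hw, hw'⟩ : ∃ w, (w = u ∨ w = v) ∧ w ∈ lineClosure B x y :=
    hw.elim (fun k => ⟨u, Or.inl rfl, k⟩) fun k => ⟨v, Or.inr rfl, k⟩
  have hsub' : insert x (insert y (insert w (lineClosure B u v \ {u, v}))) ⊆ lineClosure B x y := by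
    intro z hz
    simp only [Finset.mem_insert] at hz
    rcases hz with rfl | rfl | rfl | hz
    exacts [left_mem_lineClosure _ _ _, right_mem_lineClosure _ _ _, hw', hsub hz]
  have := Finset.card_le_card hsub'
  have hne : ∀ z ∈ S, z ∉ insert w (lineClosure B u v \ {u, v}) := by
    intro z hz hz'
    rw [Finset.mem_insert] at hz'
    rcases hz' with rfl | hz'
    · exact hw.elim (h.left z hz).1 (h.left z hz).2
    · exact hS z hz (hPm hz').2.2
  rw [card_lineClosure hdes hss hyx.symm, Finset.card_insert_of_notMem,
    Finset.card_insert_of_notMem (hne y hyS), Finset.card_insert_of_notMem, hP] at this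
  · omega
  · rcases hw with rfl | rfl <;> simp
  · rw [Finset.mem_insert, not_or]
    exact ⟨hyx.symm, hne x hx⟩

theorem IsSplit.eq_empty (hdes : IsTwoDesign B 2) (hss : HGSupersimple B)
    (hn : 13 ≤ Fintype.card Ω) (h : IsSplit B u v S T) (hS : S.Nonempty) : T = ∅ := by
  rw [← Finset.not_nonempty_iff_eq_empty]
  intro hT
  by_cases hS' : ∀ z ∈ S, z ∉ lineClosure B u v
  · exact h.false_of_disjoint hdes hss hn hS hS'
  by_cases hT' : ∀ z ∈ T, z ∉ lineClosure B u v
  · exact h.symm.false_of_disjoint hdes hss hn hT hT'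
  push Not at hS' hT'
  obtain ⟨a, ha, ha'⟩ := hS'
  obtain ⟨b, hb, hb'⟩ := hT'
  have h1 := h.card_right_le_five hdes hss ha ha'
  have h2 := h.symm.card_right_le_five hdes hss hb hb'
  have := h.card_add_card
  omega
end

section
variable {B : Finset (Finset Ω)}

omit [Fintype Ω] in
theorem exists_isElemMove (hdes : IsTwoDesign B 2) (hss : HGSupersimple B) {x y : Ω}
    (hxy : x ≠ y) : ∃ e, IsElemMove B x y e := by
  obtain ⟨a, b, hL, k1, k2, k3, k4, k5⟩ := exists_line hdes hxy
  obtain ⟨c, d, hM, l1, l2, l3, l4, l5, l6, l7, l8⟩ := exists_second_line hdes hss hL hxy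
    (by simp) (by simp)
  exact ⟨_, isElemMove_swaps hxy hL hM k1 k2 k3 k4 k5 l1 l2 l3 l4 l5 l6 l7 l8⟩

theorem IsElemMove.apply_of_notMem_lineClosure {x y z : Ω} {e : Perm Ω} (h : IsElemMove B x y e)
    (hz : z ∉ lineClosure B x y) : e z = z := by
  rw [mem_lineClosure, not_or, not_or] at hz
  rcases h with ⟨rfl, rfl⟩ | ⟨_, _, _, _, h⟩
  · rfl
  · exact (h z hz.1 hz.2.1).1 fun L hL k => hz.2.2 ⟨L, hL, k⟩

/-- Some move sequence takes the hole from `h` to `h'`, the marker `u` to `u'` and the marker `v`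
to `v'`. -/
def MarkedReach (B : Finset (Finset Ω)) (h u v h' u' v' : Ω) : Prop :=
  ∃ g, Reach B h h' g ∧ g u = u' ∧ g v = v'

variable {h u v w h' u' v' h'' u'' v'' : Ω}

omit [DecidableEq Ω] [Fintype Ω] in
theorem MarkedReach.refl (h u v : Ω) : MarkedReach B h u v h u v := ⟨1, Reach.refl h, rfl, rfl⟩

omit [DecidableEq Ω] [Fintype Ω] in
theorem MarkedReach.trans (k : MarkedReach B h u v h' u' v')
    (l : MarkedReach B h' u' v' h'' u'' v'') : MarkedReach B h u v h'' u'' v'' := by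
  obtain ⟨g, hg, rfl, rfl⟩ := k
  obtain ⟨f, hf, rfl, rfl⟩ := l
  exact ⟨f * g, hg.trans hf, rfl, rfl⟩

omit [DecidableEq Ω] [Fintype Ω] in
theorem MarkedReach.symm (k : MarkedReach B h u v h' u' v') : MarkedReach B h' u' v' h u v := by
  obtain ⟨g, hg, rfl, rfl⟩ := k
  exact ⟨g⁻¹, hg.symm, by simp, by simp⟩

omit [DecidableEq Ω] [Fintype Ω] in
theorem MarkedReach.swap (k : MarkedReach B h u v h' u' v') : MarkedReach B h v u h' v' u' := by
  obtain ⟨g, hg, h1, h2⟩ := k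
  exact ⟨g, hg, h2, h1⟩

theorem markedReach_of_notMem (hdes : IsTwoDesign B 2) (hss : HGSupersimple B)
    (hne : h ≠ h') (hu : u ∉ lineClosure B h h') (hv : v ∉ lineClosure B h h') :
    MarkedReach B h u v h' u v := by
  obtain ⟨e, he⟩ := exists_isElemMove hdes hss hne
  exact ⟨e, he.reach, he.apply_of_notMem_lineClosure hu, he.apply_of_notMem_lineClosure hv⟩

theorem markedReach_exchange (hdes : IsTwoDesign B 2) (hss : HGSupersimple B)
    (hne : h ≠ u) (hv : v ∉ lineClosure B h u) : MarkedReach B h u v u h v := by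
  obtain ⟨e, he⟩ := exists_isElemMove hdes hss hne
  refine ⟨e, he.reach, ?_, he.apply_of_notMem_lineClosure hv⟩
  rcases he with ⟨rfl, _⟩ | ⟨_, _, _, hu, _⟩
  · exact absurd rfl hne
  · exact hu

theorem markedReach_hole (hdes : IsTwoDesign B 2) (hss : HGSupersimple B)
    (hn : 13 ≤ Fintype.card Ω) (huv : u ≠ v) (hu : h ≠ u) (hv : h ≠ v) (hu' : h' ≠ u)
    (hv' : h' ≠ v) : MarkedReach B h u v h' u v := by
  classical
  have hs : IsSplit B u v
      (Finset.univ.filter fun z => (z ≠ u ∧ z ≠ v) ∧ MarkedReach B h u v z u v)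
      (Finset.univ.filter fun z => (z ≠ u ∧ z ≠ v) ∧ ¬MarkedReach B h u v z u v) := by
    refine ⟨huv, ?_, ?_, ?_, ?_, ?_⟩
    · intro z zu zv
      by_cases k : MarkedReach B h u v z u v <;> simp [zu, zv, k]
    · intro z hz hz'
      simp only [Finset.mem_filter] at hz hz'
      exact hz'.2.2 hz.2.2
    · intro z hz
      exact (Finset.mem_filter.mp hz).2.1
    · intro z hz
      exact (Finset.mem_filter.mp hz).2.1
    · intro a ha b hb
      by_contra! q
      simp only [Finset.mem_filter, Finset.mem_univ, true_and] at ha hb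
      have hab : a ≠ b := fun e => hb.2 (e ▸ ha.2)
      exact hb.2 (ha.2.trans (markedReach_of_notMem hdes hss hab
        (fun k => q.1 (mem_lineClosure_right ha.1.1.symm hb.1.1.symm hab k))
        (fun k => q.2 (mem_lineClosure_right ha.1.2.symm hb.1.2.symm hab k))))
  have h1 := hs.eq_empty hdes hss hn ⟨h, by simp [hu, hv, MarkedReach.refl]⟩
  by_contra q
  have : h' ∈ (∅ : Finset Ω) := by rw [← h1]; simp [hu', hv', q]
  simp at this

theorem markedReach_of_notMem_lineClosure (hdes : IsTwoDesign B 2) (hss : HGSupersimple B)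
    (hn : 13 ≤ Fintype.card Ω) (huv : u ≠ v) (hu : h ≠ u) (hv : h ≠ v) (hw : h' ≠ w) (hv' : h' ≠ v)
    (hwm : w ∉ lineClosure B u v) : MarkedReach B h u v h' w v := by
  have hwu : w ≠ u := fun e => hwm (e ▸ left_mem_lineClosure B u v)
  have hwv : w ≠ v := fun e => hwm (e ▸ right_mem_lineClosure B u v)
  have h1 := markedReach_hole hdes hss hn huv hu hv hwu hwv
  have h2 : MarkedReach B w u v u w v := markedReach_exchange hdes hss hwu fun k => hwm
    (mem_lineClosure_rotate hwv.symm huv.symm k)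
  exact (h1.trans h2).trans (markedReach_hole hdes hss hn hwv hwu.symm huv hw hv')

theorem markedReach_left (hdes : IsTwoDesign B 2) (hss : HGSupersimple B)
    (hn : 13 ≤ Fintype.card Ω) (hu : h ≠ u) (hv : h ≠ v) (hw : h ≠ w) (huv : u ≠ v) (hwv : w ≠ v) :
    MarkedReach B h u v h w v := by
  obtain ⟨t, ht⟩ : ∃ t, t ∉ insert h (lineClosure B u v ∪ (lineClosure B w v).erase v) := by
    by_contra! q
    have h1 := Finset.card_le_card (s := Finset.univ) fun z _ => q z
    have h2 := Finset.card_insert_le h (lineClosure B u v ∪ (lineClosure B w v).erase v)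
    have h3 := Finset.card_union_le (lineClosure B u v) ((lineClosure B w v).erase v)
    rw [Finset.card_erase_of_mem (right_mem_lineClosure B w v), card_lineClosure hdes hss huv,
      card_lineClosure hdes hss hwv] at h3
    rw [Finset.card_univ] at h1
    omega
  simp only [Finset.mem_insert, Finset.mem_union, Finset.mem_erase, not_or, not_and] at ht
  obtain ⟨th, tu, tw⟩ := ht
  have tv : t ≠ v := fun e => tu (e ▸ right_mem_lineClosure B u v)
  have h1 := markedReach_of_notMem_lineClosure hdes hss hn huv hu hv (Ne.symm th) hv tu
  have h2 := markedReach_of_notMem_lineClosure hdes hss hn hwv hw hv (Ne.symm th) hv (tw tv)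
  exact h1.trans h2.symm

theorem markedReach_pair (hdes : IsTwoDesign B 2) (hss : HGSupersimple B)
    (hn : 13 ≤ Fintype.card Ω) (hu : h ≠ u) (hv : h ≠ v) (hu' : h ≠ u') (hv' : h ≠ v') (huv : u ≠ v)
    (huv' : u' ≠ v') : MarkedReach B h u v h u' v' := by
  obtain ⟨t, ht⟩ : ∃ t, t ∉ ({h, v, v'} : Finset Ω) := by
    by_contra! q
    have h1 := Finset.card_le_card (s := Finset.univ) (t := {h, v, v'}) fun z _ => q z
    have h2 := Finset.card_le_three (a := h) (b := v) (c := v')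
    rw [Finset.card_univ] at h1
    omega
  simp only [Finset.mem_insert, Finset.mem_singleton, not_or] at ht
  obtain ⟨th, tv, tv'⟩ := ht
  have h1 : MarkedReach B h u v h t v :=
    markedReach_left hdes hss hn hu hv (Ne.symm th) huv tv
  have h2 : MarkedReach B h v t h v' t :=
    markedReach_left hdes hss hn hv (Ne.symm th) hv' (Ne.symm tv) (Ne.symm tv')
  have h3 : MarkedReach B h t v' h u' v' :=
    markedReach_left hdes hss hn (Ne.symm th) hv' hu' tv' huv'
  exact (h1.trans h2.swap).trans h3

theorem twoTrans_comap_holeSubgroup (hdes : IsTwoDesign B 2) (hss : HGSupersimple B)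
    (hn : 13 ≤ Fintype.card Ω) (x : Ω) :
    TwoTrans ((holeSubgroup B x).comap (Perm.ofSubtype (p := fun y => y ≠ x))) := by
  intro a b c d hab hcd
  obtain ⟨g, hg, h1, h2⟩ := markedReach_pair hdes hss hn a.2.symm b.2.symm c.2.symm d.2.symm
    (fun e => hab (Subtype.ext e)) (fun e => hcd (Subtype.ext e))
  have hx : ∀ y, g y ≠ x ↔ y ≠ x := by
    intro y
    conv_lhs => rw [← hg.apply_left]
    simp
  have hy : ∀ y, g y ≠ y → y ≠ x := by
    rintro y hy rfl; exact hy hg.apply_left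
  refine ⟨g.subtypePerm hx, ?_, Subtype.ext h1, Subtype.ext h2⟩
  rw [Subgroup.mem_comap, Perm.ofSubtype_subtypePerm hx hy]
  exact hg

theorem holeStab_of_thirteen_le_card (hdes : IsTwoDesign B 2) (hss : HGSupersimple B)
    (hn : 13 ≤ Fintype.card Ω) (x : Ω) : holeStab B x = {g | g x = x} := by
  have : Nontrivial Ω := Fintype.one_lt_card_iff_nontrivial.mp (by omega)
  obtain ⟨y, hy⟩ := exists_ne x
  obtain ⟨a, b, c, d, p, q, ⟨ha, hb, hc, hd, hp, hq⟩, hab, hcd, hpq, h12, h13, h23, hr⟩ :=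
    exists_reach_three_swaps hdes hss hy.symm
  have sym2 : ∀ {a b c d : {y // y ≠ x}}, s((a : Ω), (b : Ω)) ≠ s((c : Ω), (d : Ω)) →
      s(a, b) ≠ s(c, d) := by
    intro a b c d k e
    exact k (by simpa using congrArg (Sym2.map Subtype.val) e)
  apply holeStab_eq_of_comap_eq_top
  refine (twoTrans_comap_holeSubgroup hdes hss hn x).eq_top_of_swaps (a := ⟨a, ha⟩) (b := ⟨b, hb⟩)
    (c := ⟨c, hc⟩) (d := ⟨d, hd⟩) (p := ⟨p, hp⟩) (q := ⟨q, hq⟩) ?_ ?_ ?_ ?_ (sym2 h12) (sym2 h13)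
    (sym2 h23) ?_
  · refine le_of_le_of_eq (b := Fintype.card Ω - 1) (by omega)
      (Eq.symm ((Fintype.card_subtype_compl fun y : Ω => y = x).trans ?_))
    rw [Fintype.card_subtype_eq]
  · exact fun e => hab (congrArg Subtype.val e)
  · exact fun e => hcd (congrArg Subtype.val e)
  · exact fun e => hpq (congrArg Subtype.val e)
  · rw [Subgroup.mem_comap, map_mul, map_mul, Perm.ofSubtype_swap_eq, Perm.ofSubtype_swap_eq,
      Perm.ofSubtype_swap_eq]
    exact hr
end

/-- (Theorem C(b)) For a supersimple 2-(n,4,2) design with `n ≥ 7`: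
`n ≡ 1 (mod 3)`, and if `n ≠ 10` then every hole stabilizer is exactly the full
symmetric group on `Ω \ {∞}`. -/
theorem stmt6 (B : Finset (Finset Ω)) (n : ℕ) (hn : Fintype.card Ω = n) (hn7 : 7 ≤ n)
    (hdes : IsTwoDesign B 2) (hss : HGSupersimple B) :
    n % 3 = 1 ∧
    (n ≠ 10 → ∀ x : Ω, holeStab B x = { g : Equiv.Perm Ω | g x = x }) := by
  subst hn
  have hpos : 0 < Fintype.card Ω := by omega
  obtain ⟨x⟩ := Fintype.card_pos_iff.mp hpos
  have h3 := hdes.card_mod_three x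
  refine ⟨h3, fun h10 y => ?_⟩
  rcases (by omega : Fintype.card Ω = 7 ∨ 13 ≤ Fintype.card Ω) with h7 | h13
  · exact holeStab_of_card_seven hdes hss h7 y
  · exact holeStab_of_thirteen_le_card hdes hss h13 y
end

section
/- Let 𝓓 = (Ω, 𝓑) be a supersimple 2-(n,4,λ) design, ∞ ∈ Ω, and suppose G = π_∞(𝓓) is transitive on Ω \ {∞} and preserves a system of imprimitivity with ℓ blocks each of size k. Suppose moreover that whenever a, c ∈ Ω \ {∞} lie in the same block of imprimitivity, ∞ ∈ overline{a,c}. Then k ≤ 2λ + 1, and if λ ≡ 2 (mod 3) then k ≤ 2λ − 1. Furthermore, if k > 2λ − 1 then k = 2λ + 1, and in that case, for any block Δ, the 3-element sets α \ {∞}, where α ranges over the lines containing ∞ and two points of Δ, are subsets of Δ forming the lines of a 2-(k,3,1) design on Δ. -/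
open Equiv

variable {Ω : Type*} [DecidableEq Ω] [Fintype Ω]

/-- In a supersimple hypergraph, lines sharing three distinct points are equal. -/
theorem HGSupersimple.pliable {B : Finset (Finset Ω)} (hss : HGSupersimple B) :
    HGPliable B := by
  intro b₁ h₁ b₂ h₂ p q r hpq hpr hqr p₁ q₁ r₁ p₂ q₂ r₂
  by_contra hne
  have hsub : ({p, q, r} : Finset Ω) ⊆ b₁ ∩ b₂ := by
    intro z hz
    simp only [Finset.mem_insert, Finset.mem_singleton] at hz
    rcases hz with rfl | rfl | rfl <;> simp [*]
  have h := Finset.card_le_card hsub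
  rw [Finset.card_eq_three.2 ⟨p, q, r, hpq, hpr, hqr, rfl⟩] at h
  have := hss b₁ h₁ b₂ h₂ hne
  omega

/-- A line of size four loses two points when two of its points are removed. -/
theorem card_line_sdiff_pair {b : Finset Ω} (hb : b.card = 4) {x a : Ω} (hxa : x ≠ a)
    (hx : x ∈ b) (ha : a ∈ b) : (b \ {x, a}).card = 2 := by
  have hsub : ({x, a} : Finset Ω) ⊆ b := by
    simp [Finset.insert_subset_iff, hx, ha]
  rw [Finset.card_sdiff_of_subset hsub, hb, Finset.card_pair hxa]

/-- If every other point of `Δ` lies on a line of `F` through `x` and `a`, then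
`|Δ| ≤ 2 |F| + 1`. -/
theorem card_le_of_covered {F : Finset (Finset Ω)} {x a : Ω} {Δ : Finset Ω} (hxa : x ≠ a)
    (hF : ∀ b ∈ F, b.card = 4 ∧ x ∈ b ∧ a ∈ b) (haΔ : a ∈ Δ)
    (hcov : ∀ c ∈ Δ, c ≠ a → ∃ b ∈ F, c ∈ b \ {x, a}) : Δ.card ≤ 2 * F.card + 1 := by
  have hsub : Δ.erase a ⊆ F.biUnion fun b => b \ {x, a} := by
    intro c hc
    obtain ⟨b, hb, hcb⟩ := hcov c (Finset.mem_of_mem_erase hc) (Finset.ne_of_mem_erase hc)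
    exact Finset.mem_biUnion.2 ⟨b, hb, hcb⟩
  have h₁ := Finset.card_le_card hsub
  have h₂ : (F.biUnion fun b => b \ {x, a}).card ≤ F.card * 2 :=
    Finset.card_biUnion_le_card_mul _ _ _ fun b hb =>
      (card_line_sdiff_pair (hF b hb).1 hxa (hF b hb).2.1 (hF b hb).2.2).le
  rw [Finset.card_erase_of_mem haΔ] at h₁
  omega

/-- If `Δ` contains `a` and all points other than `x` on the lines of `F` through `x` and `a`,
and these lines meet only in `x` and `a`, then `2 |F| + 1 ≤ |Δ|`. -/
theorem le_card_of_lines_subset {B F : Finset (Finset Ω)} (hB : HGPliable B) (hFB : F ⊆ B)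
    {x a : Ω} {Δ : Finset Ω} (hxa : x ≠ a)
    (hF : ∀ b ∈ F, b.card = 4 ∧ x ∈ b ∧ a ∈ b) (haΔ : a ∈ Δ)
    (hsub : ∀ b ∈ F, ∀ w ∈ b, w ≠ x → w ∈ Δ) : 2 * F.card + 1 ≤ Δ.card := by
  have hsub' : (F.biUnion fun b => b \ {x, a}) ⊆ Δ.erase a := by
    intro w hw
    obtain ⟨b, hb, hwb⟩ := Finset.mem_biUnion.1 hw
    simp only [Finset.mem_sdiff, Finset.mem_insert, Finset.mem_singleton, not_or] at hwb
    exact Finset.mem_erase.2 ⟨hwb.2.2, hsub b hb w hwb.1 hwb.2.1⟩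
  have hdisj : ∀ b₁ ∈ F, ∀ b₂ ∈ F, b₁ ≠ b₂ → Disjoint (b₁ \ {x, a}) (b₂ \ {x, a}) := by
    intro b₁ h₁ b₂ h₂ hne
    rw [Finset.disjoint_left]
    intro w hw₁ hw₂
    simp only [Finset.mem_sdiff, Finset.mem_insert, Finset.mem_singleton, not_or] at hw₁ hw₂
    exact hne (hB b₁ (hFB h₁) b₂ (hFB h₂) x a w hxa (Ne.symm hw₁.2.1) (Ne.symm hw₁.2.2)
      (hF b₁ h₁).2.1 (hF b₁ h₁).2.2 hw₁.1 (hF b₂ h₂).2.1 (hF b₂ h₂).2.2 hw₂.1)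
  have hle := Finset.card_le_card hsub'
  rw [Finset.card_biUnion hdisj, Finset.sum_congr rfl fun b hb =>
    card_line_sdiff_pair (hF b hb).1 hxa (hF b hb).2.1 (hF b hb).2.2,
    Finset.card_erase_of_mem haΔ, Finset.sum_const, smul_eq_mul] at hle
  have := Finset.card_pos.2 ⟨a, haΔ⟩
  omega

/-- If every point of `Δ` lies on exactly `r` lines through `x`, and the lines through `x`
meeting `Δ` stay inside `Δ` apart from `x`, then `3` divides `|Δ| r`. -/
theorem three_dvd_card_mul {B : Finset (Finset Ω)} (hB : ∀ b ∈ B, b.card = 4) {x : Ω}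
    {Δ : Finset Ω} (hx : x ∉ Δ) {r : ℕ}
    (hr : ∀ a ∈ Δ, (B.filter fun b => x ∈ b ∧ a ∈ b).card = r)
    (hclosed : ∀ b ∈ B, x ∈ b → ∀ p ∈ b, p ∈ Δ → ∀ w ∈ b, w ≠ x → w ∈ Δ) :
    3 ∣ Δ.card * r := by
  set L := B.filter fun b => x ∈ b ∧ b.erase x ⊆ Δ with hL
  have hcount := Finset.sum_card_bipartiteAbove_eq_sum_card_bipartiteBelow
    (s := Δ) (t := L) (fun a b => a ∈ b)
  have habove : ∀ a ∈ Δ, (Finset.bipartiteAbove (fun a b => a ∈ b) L a).card = r := by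
    intro a ha
    rw [← hr a ha]
    congr 1
    ext b
    simp only [Finset.bipartiteAbove, hL, Finset.mem_filter]
    constructor
    · rintro ⟨⟨hb, hxb, -⟩, hab⟩
      exact ⟨hb, hxb, hab⟩
    · rintro ⟨hb, hxb, hab⟩
      exact ⟨⟨hb, hxb, fun w hw => hclosed b hb hxb a hab ha w (Finset.mem_of_mem_erase hw)
        (Finset.ne_of_mem_erase hw)⟩, hab⟩
  have hbelow : ∀ b ∈ L, (Finset.bipartiteBelow (fun a b => a ∈ b) Δ b).card = 3 := by
    intro b hb
    simp only [hL, Finset.mem_filter] at hb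
    have : Finset.bipartiteBelow (fun a b => a ∈ b) Δ b = b.erase x := by
      ext w
      simp only [Finset.bipartiteBelow, Finset.mem_filter, Finset.mem_erase]
      exact ⟨fun h => ⟨fun hw => hx (hw ▸ h.1), h.2⟩,
        fun h => ⟨hb.2.2 (Finset.mem_erase.2 h), h.2⟩⟩
    rw [this, Finset.card_erase_of_mem hb.2.1, hB b hb.1]
  rw [Finset.sum_congr rfl habove, Finset.sum_congr rfl hbelow] at hcount
  simp only [Finset.sum_const, smul_eq_mul] at hcount
  exact ⟨L.card, by rw [hcount, mul_comm]⟩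

/-- (Lemma 5.3) Suppose the hole stabilizer is transitive and preserves
a system of imprimitivity with `ℓ` blocks of size `k`, and points in a common block
always satisfy `∞ ∈ overline{a,c}`. Then `k ≤ 2λ + 1`; if `λ ≡ 2 (mod 3)` then
`k ≤ 2λ - 1`; and if `k > 2λ - 1` then `k = 2λ + 1` and each block Δ carries a
2-(k,3,1) design whose lines are the sets `α \ {∞}` for lines `α` through `∞` meeting
Δ in two points. -/
theorem stmt9 (B : Finset (Finset Ω)) (n lam : ℕ) (hn : Fintype.card Ω = n)
    (hlam : 0 < lam) (hdes : IsTwoDesign B lam) (hss : HGSupersimple B) (x : Ω)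
    (htrans : ∀ a b : Ω, a ≠ x → b ≠ x → ∃ g ∈ holeStab B x, g a = b)
    (P : Finset (Finset Ω)) (k ℓ : ℕ) (hP : IsHoleBlockSystem B x P k ℓ)
    (hsame : ∀ a c : Ω, a ≠ x → c ≠ x → a ≠ c →
      (∃ Δ ∈ P, a ∈ Δ ∧ c ∈ Δ) → HGLineClosure B a c x) :
    k ≤ 2 * lam + 1 ∧
    (lam % 3 = 2 → k ≤ 2 * lam - 1) ∧
    (2 * lam - 1 < k → k = 2 * lam + 1 ∧
      ∀ Δ ∈ P,
        (∀ α ∈ B, x ∈ α → ∀ p ∈ α, ∀ q ∈ α, p ≠ q → p ∈ Δ → q ∈ Δ →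
          ∀ w ∈ α, w ≠ x → w ∈ Δ) ∧
        (∀ p ∈ Δ, ∀ q ∈ Δ, p ≠ q →
          (B.filter fun α => x ∈ α ∧ p ∈ α ∧ q ∈ α).card = 1)) := by
  obtain ⟨hPcard, hk, hℓ, hcard, hex, hxP, -⟩ := hP
  obtain ⟨h4, hlam'⟩ := hdes
  have hne : ∀ Δ ∈ P, ∀ a ∈ Δ, x ≠ a := fun Δ hΔ a ha hxa => hxP Δ hΔ (hxa ▸ ha)
  have hblock : ∀ Δ ∈ P, ∀ Δ' ∈ P, ∀ a, a ∈ Δ → a ∈ Δ' → Δ = Δ' := fun Δ hΔ Δ' hΔ' a ha ha' =>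
    (hex a (hne Δ hΔ a ha).symm).unique ⟨hΔ, ha⟩ ⟨hΔ', ha'⟩
  have hF : ∀ a, ∀ b ∈ B.filter (fun b => x ∈ b ∧ a ∈ b), b.card = 4 ∧ x ∈ b ∧ a ∈ b := by
    intro a b hb
    rw [Finset.mem_filter] at hb
    exact ⟨h4 b hb.1, hb.2⟩
  have hline : ∀ Δ ∈ P, ∀ a ∈ Δ, ∀ c ∈ Δ, a ≠ c → ∃ b ∈ B, x ∈ b ∧ a ∈ b ∧ c ∈ b := by
    intro Δ hΔ a ha c hc hac
    rcases hsame a c (hne Δ hΔ a ha).symm (hne Δ hΔ c hc).symm hac ⟨Δ, hΔ, ha, hc⟩ with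
      h | h | ⟨b, hb, hab, hcb, hxb⟩
    · exact absurd h (hne Δ hΔ a ha)
    · exact absurd h (hne Δ hΔ c hc)
    · exact ⟨b, hb, hxb, hab, hcb⟩
  have hcover : ∀ Δ ∈ P, ∀ a ∈ Δ, ∀ c ∈ Δ, c ≠ a →
      ∃ b ∈ B.filter (fun b => x ∈ b ∧ a ∈ b), c ∈ b \ {x, a} := by
    intro Δ hΔ a ha c hc hca
    obtain ⟨b, hb, hxb, hab, hcb⟩ := hline Δ hΔ a ha c hc hca.symm
    exact ⟨b, Finset.mem_filter.2 ⟨hb, hxb, hab⟩, by simp [hcb, hca, (hne Δ hΔ c hc).symm]⟩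
  obtain ⟨Δ₀, hΔ₀⟩ : P.Nonempty := Finset.card_pos.1 (by omega)
  obtain ⟨a₀, ha₀⟩ : Δ₀.Nonempty := Finset.card_pos.1 (by rw [hcard Δ₀ hΔ₀]; omega)
  have hupper : k ≤ 2 * lam + 1 := by
    have := card_le_of_covered (hne Δ₀ hΔ₀ a₀ ha₀) (hF a₀) ha₀ (hcover Δ₀ hΔ₀ a₀ ha₀)
    rwa [hcard Δ₀ hΔ₀, hlam' x a₀ (hne Δ₀ hΔ₀ a₀ ha₀)] at this
  have hmate : 2 * lam - 1 < k → ∀ Δ ∈ P, ∀ a ∈ Δ, ∀ α ∈ B, x ∈ α → a ∈ α →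
      ∃ u ∈ α, u ≠ x ∧ u ≠ a ∧ u ∈ Δ := by
    intro hlt Δ hΔ a ha α hα hxα haα
    by_contra! hnone
    have hαF : α ∈ B.filter (fun b => x ∈ b ∧ a ∈ b) := Finset.mem_filter.2 ⟨hα, hxα, haα⟩
    have hle := card_le_of_covered (F := (B.filter fun b => x ∈ b ∧ a ∈ b).erase α)
      (hne Δ hΔ a ha) (fun b hb => hF a b (Finset.mem_of_mem_erase hb)) ha (by
        intro c hc hca
        obtain ⟨b, hb, hcb⟩ := hcover Δ hΔ a ha c hc hca
        refine ⟨b, Finset.mem_erase.2 ⟨?_, hb⟩, hcb⟩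
        rintro rfl
        exact hnone c (Finset.mem_sdiff.1 hcb).1 (hne Δ hΔ c hc).symm hca hc)
    rw [Finset.card_erase_of_mem hαF, hcard Δ hΔ, hlam' x a (hne Δ hΔ a ha)] at hle
    omega
  have hclosed : 2 * lam - 1 < k → ∀ Δ ∈ P, ∀ α ∈ B, x ∈ α → ∀ p ∈ α, p ∈ Δ →
      ∀ w ∈ α, w ≠ x → w ∈ Δ := by
    intro hlt Δ hΔ α hα hxα p hpα hpΔ w hwα hwx
    by_contra hwΔ
    obtain ⟨Δ', ⟨hΔ', hwΔ'⟩, -⟩ := hex w hwx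
    have hsep : ∀ z ∈ Δ, ∀ y ∈ Δ', z ≠ y := by
      rintro z hz y hy rfl
      exact hwΔ (hblock Δ hΔ Δ' hΔ' z hz hy ▸ hwΔ')
    obtain ⟨v, hvα, hvx, hvp, hvΔ⟩ := hmate hlt Δ hΔ p hpΔ α hα hxα hpα
    obtain ⟨u, huα, hux, huw, huΔ'⟩ := hmate hlt Δ' hΔ' w hwΔ' α hα hxα hwα
    have hsub : ({x, p, v, w, u} : Finset Ω) ⊆ α := by
      simp [Finset.insert_subset_iff, *]
    have hle := Finset.card_le_card hsub
    have hxp := hne Δ hΔ p hpΔ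
    have hpw := hsep p hpΔ w hwΔ'
    have hpu := hsep p hpΔ u huΔ'
    have hvw := hsep v hvΔ w hwΔ'
    have hvu := hsep v hvΔ u huΔ'
    rw [h4 α hα, Finset.card_insert_of_notMem (by simp [hxp, hvx.symm, hwx.symm, hux.symm]),
      Finset.card_insert_of_notMem (by simp [hvp.symm, hpw, hpu]),
      Finset.card_insert_of_notMem (by simp [hvw, hvu]),
      Finset.card_pair huw.symm] at hle
    omega
  have hlarge : 2 * lam - 1 < k → k = 2 * lam + 1 := by
    intro hlt
    have hxa := hne Δ₀ hΔ₀ a₀ ha₀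
    have := le_card_of_lines_subset hss.pliable (Finset.filter_subset _ B) hxa (hF a₀) ha₀ (by
      intro b hb w hwb hwx
      rw [Finset.mem_filter] at hb
      exact hclosed hlt Δ₀ hΔ₀ b hb.1 hb.2.1 a₀ hb.2.2 ha₀ w hwb hwx)
    rw [hcard Δ₀ hΔ₀, hlam' x a₀ hxa] at this
    omega
  refine ⟨hupper, fun hmod => ?_, fun hlt => ⟨hlarge hlt, fun Δ hΔ => ⟨?_, ?_⟩⟩⟩
  · by_contra! hlt
    have hdvd := three_dvd_card_mul h4 (hxP Δ₀ hΔ₀)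
      (fun a ha => hlam' x a (hne Δ₀ hΔ₀ a ha)) (hclosed hlt Δ₀ hΔ₀)
    rw [hcard Δ₀ hΔ₀, hlarge hlt, Nat.dvd_iff_mod_eq_zero, Nat.mul_mod, Nat.add_mod,
      Nat.mul_mod 2, hmod] at hdvd
    norm_num at hdvd
  · intro α hα hxα p hpα _ _ _ hpΔ _
    exact hclosed hlt Δ hΔ α hα hxα p hpα hpΔ
  · intro p hp q hq hpq
    obtain ⟨b, hb, hxb, hpb, hqb⟩ := hline Δ hΔ p hp q hq hpq
    refine Finset.card_eq_one.2 ⟨b, Finset.eq_singleton_iff_unique_mem.2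
      ⟨Finset.mem_filter.2 ⟨hb, hxb, hpb, hqb⟩, fun c hc => ?_⟩⟩
    obtain ⟨hc, hxc, hpc, hqc⟩ := Finset.mem_filter.1 hc
    exact hss.pliable c hc b hb x p q (hne Δ hΔ p hp) (hne Δ hΔ q hq) hpq
      hxc hpc hqc hxb hpb hqb
end
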